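/- Let w be an Oleinik solution on [0,X]. For any 0 < ε < X and any integers k ≥ 0 and m ≥ 0 there exist δ > 0 and a constant C > 0, independent of ψ, such that |∂_ψ^m ∂ₓ^k w(x,ψ)| ≤ C ψ^{1−m} for all (x,ψ) ∈ [ε,X]×(0,δ]. -/

import Mathlib

open Set

/-- Iterated partial derivative `∂ₓ^k ∂_ψ^m w` of a function of two real variables. -/
noncomputable def pd (k m : ℕ) (w : ℝ → ℝ → ℝ) (x ψ : ℝ) : ℝ :=
  iteratedDeriv k (fun x' => iteratedDeriv m (w x') ψ) x

/-- Von Mises formulation of the steady Prandtl equation with favorable pressure: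
`w` is an Oleinik solution on `[0,X]` with structural constants `α, m, M, C₀, δ₁`. -/
structure OleinikSolution (X : ℝ) (p : ℝ → ℝ) (w : ℝ → ℝ → ℝ)
    (α m M C₀ δ₁ : ℝ) : Prop where
  hX : 0 < X
  hp : ContDiff ℝ (⊤ : ℕ∞) p
  hfav : ∀ x : ℝ, deriv p x ≤ 0
  hα : α ∈ Set.Ioo (0 : ℝ) (1 / 2)
  hm : 0 < m
  hmM : m < M
  hC₀ : 0 < C₀
  hδ₁ : δ₁ ∈ Set.Ioo (0 : ℝ) 1
  cont : ContinuousOn (fun z : ℝ × ℝ => w z.1 z.2) (Set.Icc 0 X ×ˢ Set.Ici 0)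
  smooth : ContDiffOn ℝ (⊤ : ℕ∞) (fun z : ℝ × ℝ => w z.1 z.2) (Set.Ioc 0 X ×ˢ Set.Ioi 0)
  bdry : ∀ x ∈ Set.Icc (0 : ℝ) X, w x 0 = 0
  eqn : ∀ x ∈ Set.Ioc (0 : ℝ) X, ∀ ψ ∈ Set.Ioi (0 : ℝ),
    pd 1 0 w x ψ - Real.sqrt (w x ψ) * pd 0 2 w x ψ = -2 * deriv p x
  slope_lb : ∀ x ∈ Set.Icc (0 : ℝ) X, ∀ ψ ∈ Set.Icc (0 : ℝ) δ₁, m < pd 0 1 w x ψ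
  slope_ub : ∀ x ∈ Set.Icc (0 : ℝ) X, ∀ ψ ∈ Set.Icc (0 : ℝ) δ₁, pd 0 1 w x ψ < M
  growth_lb : ∀ x ∈ Set.Icc (0 : ℝ) X, ∀ ψ ∈ Set.Ioc (0 : ℝ) δ₁, m * ψ < w x ψ
  growth_ub : ∀ x ∈ Set.Icc (0 : ℝ) X, ∀ ψ ∈ Set.Ioc (0 : ℝ) δ₁, w x ψ < M * ψ
  dx_bound : ∀ x ∈ Set.Icc (0 : ℝ) X, ∀ ψ ∈ Set.Icc (0 : ℝ) δ₁,
    |pd 1 0 w x ψ| ≤ C₀ * ψ ^ ((1 : ℝ) / 2 + α)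

open Set
set_option linter.unusedVariables false
namespace Ole
open Filter Topology

noncomputable def dx (F : ℝ → ℝ → ℝ) (x y : ℝ) : ℝ := deriv (fun x' => F x' y) x
noncomputable def dy (F : ℝ → ℝ → ℝ) (x y : ℝ) : ℝ := deriv (F x) y

/-- smooth in the interior, with smooth extension up to `x = X`. -/
def Sm (X D : ℝ) (F : ℝ → ℝ → ℝ) : Prop :=
  ∃ g : ℝ × ℝ → ℝ, ContDiffOn ℝ (⊤ : ℕ∞) g (Ioc 0 X ×ˢ Ioo 0 D) ∧
    ∀ x ∈ Ioo 0 X, ∀ y ∈ Ioo 0 D, F x y = g (x, y)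

variable {X D : ℝ} {F G : ℝ → ℝ → ℝ}

lemma nhdU {x y : ℝ} (hx : x ∈ Ioo 0 X) (hy : y ∈ Ioo 0 D) :
    Ioo 0 X ×ˢ Ioo 0 D ∈ 𝓝 (x, y) :=
  (isOpen_Ioo.prod isOpen_Ioo).mem_nhds ⟨hx, hy⟩

lemma Sm.contDiffAt (hF : Sm X D F) {x y : ℝ} (hx : x ∈ Ioo 0 X) (hy : y ∈ Ioo 0 D) :
    ContDiffAt ℝ (⊤ : ℕ∞) (fun z : ℝ × ℝ => F z.1 z.2) (x, y) := by
  obtain ⟨g, hg, hFg⟩ := hF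
  have h1 : ContDiffAt ℝ (⊤ : ℕ∞) g (x, y) :=
    hg.contDiffAt (mem_of_superset (nhdU hx hy) (prod_mono Ioo_subset_Ioc_self le_rfl))
  refine h1.congr_of_eventuallyEq ?_
  filter_upwards [nhdU hx hy] with z hz
  exact hFg _ hz.1 _ hz.2

lemma uniqS : UniqueDiffOn ℝ (Ioc 0 X ×ˢ Ioo 0 D) :=
  (uniqueDiffOn_Ioc 0 X).prod (uniqueDiffOn_Ioo 0 D)

lemma hasDerivAt_fst {g : ℝ × ℝ → ℝ} {x y : ℝ} (h : DifferentiableAt ℝ g (x, y)) :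
    HasDerivAt (fun x' => g (x', y)) (fderiv ℝ g (x, y) (1, 0)) x := by
  have h2 : HasDerivAt (fun x' : ℝ => (x', y)) ((1 : ℝ), (0 : ℝ)) x :=
    (hasDerivAt_id x).prodMk (hasDerivAt_const x y)
  exact h.hasFDerivAt.comp_hasDerivAt x h2

lemma hasDerivAt_snd {g : ℝ × ℝ → ℝ} {x y : ℝ} (h : DifferentiableAt ℝ g (x, y)) :
    HasDerivAt (fun y' => g (x, y')) (fderiv ℝ g (x, y) (0, 1)) y := by
  have h2 : HasDerivAt (fun y' : ℝ => (x, y')) ((0 : ℝ), (1 : ℝ)) y :=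
    (hasDerivAt_const y x).prodMk (hasDerivAt_id y)
  exact h.hasFDerivAt.comp_hasDerivAt y h2

lemma Sm.differentiableAt (hF : Sm X D F) {x y : ℝ} (hx : x ∈ Ioo 0 X) (hy : y ∈ Ioo 0 D) :
    DifferentiableAt ℝ (fun z : ℝ × ℝ => F z.1 z.2) (x, y) :=
  (hF.contDiffAt hx hy).differentiableAt (by simp)

lemma Sm.dx_eq (hF : Sm X D F) {x y : ℝ} (hx : x ∈ Ioo 0 X) (hy : y ∈ Ioo 0 D) :
    dx F x y = fderiv ℝ (fun z : ℝ × ℝ => F z.1 z.2) (x, y) (1, 0) :=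
  (hasDerivAt_fst (hF.differentiableAt hx hy)).deriv

lemma Sm.dy_eq (hF : Sm X D F) {x y : ℝ} (hx : x ∈ Ioo 0 X) (hy : y ∈ Ioo 0 D) :
    dy F x y = fderiv ℝ (fun z : ℝ × ℝ => F z.1 z.2) (x, y) (0, 1) :=
  (hasDerivAt_snd (hF.differentiableAt hx hy)).deriv

lemma Sm.hdx (hF : Sm X D F) {x y : ℝ} (hx : x ∈ Ioo 0 X) (hy : y ∈ Ioo 0 D) :
    HasDerivAt (fun x' => F x' y) (dx F x y) x :=
  (hasDerivAt_fst (hF.differentiableAt hx hy)).differentiableAt.hasDerivAt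

lemma Sm.hdy (hF : Sm X D F) {x y : ℝ} (hx : x ∈ Ioo 0 X) (hy : y ∈ Ioo 0 D) :
    HasDerivAt (F x) (dy F x y) y :=
  (hasDerivAt_snd (hF.differentiableAt hx hy)).differentiableAt.hasDerivAt

lemma Sm.dv (hF : Sm X D F) (e : ℝ × ℝ) {H : ℝ → ℝ → ℝ}
    (hH : ∀ x ∈ Ioo 0 X, ∀ y ∈ Ioo 0 D,
      H x y = fderiv ℝ (fun z : ℝ × ℝ => F z.1 z.2) (x, y) e) : Sm X D H := by
  obtain ⟨g, hg, hFg⟩ := hF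
  refine ⟨fun z => fderivWithin ℝ g (Ioc 0 X ×ˢ Ioo 0 D) z e,
    (hg.fderivWithin uniqS (m := (⊤ : ℕ∞)) (by simp)).clm_apply contDiffOn_const, ?_⟩
  intro x hx y hy
  rw [hH x hx y hy]; beta_reduce
  have hn : Ioc 0 X ×ˢ Ioo 0 D ∈ 𝓝 (x, y) :=
    mem_of_superset (nhdU hx hy) (prod_mono Ioo_subset_Ioc_self le_rfl)
  rw [fderivWithin_of_mem_nhds hn]
  congr 1
  apply Filter.EventuallyEq.fderiv_eq
  filter_upwards [nhdU hx hy] with z hz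
  exact hFg _ hz.1 _ hz.2

lemma Sm.dx (hF : Sm X D F) : Sm X D (dx F) := hF.dv (1, 0) fun _ hx _ hy => hF.dx_eq hx hy
lemma Sm.dy (hF : Sm X D F) : Sm X D (dy F) := hF.dv (0, 1) fun _ hx _ hy => hF.dy_eq hx hy

lemma Sm.add (hF : Sm X D F) (hG : Sm X D G) : Sm X D (fun x y => F x y + G x y) := by
  obtain ⟨f, hf, hf'⟩ := hF
  obtain ⟨g, hg, hg'⟩ := hG
  exact ⟨_, hf.add hg, fun x hx y hy => by simp [hf' x hx y hy, hg' x hx y hy]⟩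

lemma Sm.mul (hF : Sm X D F) (hG : Sm X D G) : Sm X D (fun x y => F x y * G x y) := by
  obtain ⟨f, hf, hf'⟩ := hF
  obtain ⟨g, hg, hg'⟩ := hG
  exact ⟨_, hf.mul hg, fun x hx y hy => by simp [hf' x hx y hy, hg' x hx y hy]⟩

lemma Sm.congr (hF : Sm X D F) (h : ∀ x ∈ Ioo 0 X, ∀ y ∈ Ioo 0 D, F x y = G x y) :
    Sm X D G := by
  obtain ⟨f, hf, hf'⟩ := hF
  exact ⟨f, hf, fun x hx y hy => by rw [← h x hx y hy, hf' x hx y hy]⟩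

lemma Sm.coef {c : ℝ → ℝ} (hc : ContDiff ℝ (⊤ : ℕ∞) c) : Sm X D (fun x _ => c x) :=
  ⟨fun z => c z.1, (hc.comp contDiff_fst).contDiffOn, fun _ _ _ _ => rfl⟩

lemma dx_congr (h : ∀ x ∈ Ioo 0 X, ∀ y ∈ Ioo 0 D, F x y = G x y) :
    ∀ x ∈ Ioo 0 X, ∀ y ∈ Ioo 0 D, dx F x y = dx G x y := by
  intro x hx y hy
  apply Filter.EventuallyEq.deriv_eq
  filter_upwards [isOpen_Ioo.mem_nhds hx] with z hz
  exact h z hz y hy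

lemma dy_congr (h : ∀ x ∈ Ioo 0 X, ∀ y ∈ Ioo 0 D, F x y = G x y) :
    ∀ x ∈ Ioo 0 X, ∀ y ∈ Ioo 0 D, dy F x y = dy G x y := by
  intro x hx y hy
  apply Filter.EventuallyEq.deriv_eq
  filter_upwards [isOpen_Ioo.mem_nhds hy] with z hz
  exact h x hx z hz

/-- abstract derivation -/
structure IsDer (X D : ℝ) (d : (ℝ → ℝ → ℝ) → ℝ → ℝ → ℝ) : Prop where
  sm : ∀ F, Sm X D F → Sm X D (d F)
  add : ∀ F G, Sm X D F → Sm X D G → ∀ x ∈ Ioo 0 X, ∀ y ∈ Ioo 0 D,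
    d (fun x y => F x y + G x y) x y = d F x y + d G x y
  mul : ∀ F G, Sm X D F → Sm X D G → ∀ x ∈ Ioo 0 X, ∀ y ∈ Ioo 0 D,
    d (fun x y => F x y * G x y) x y = d F x y * G x y + F x y * d G x y
  congr : ∀ F G, (∀ x ∈ Ioo 0 X, ∀ y ∈ Ioo 0 D, F x y = G x y) →
    ∀ x ∈ Ioo 0 X, ∀ y ∈ Ioo 0 D, d F x y = d G x y

lemma isDer_dx : IsDer X D dx where
  sm F h := h.dx
  add F G hF hG x hx y hy := ((hF.hdx hx hy).add (hG.hdx hx hy)).deriv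
  mul F G hF hG x hx y hy := ((hF.hdx hx hy).mul (hG.hdx hx hy)).deriv
  congr F G h := dx_congr h

lemma isDer_dy : IsDer X D dy where
  sm F h := h.dy
  add F G hF hG x hx y hy := ((hF.hdy hx hy).add (hG.hdy hx hy)).deriv
  mul F G hF hG x hx y hy := ((hF.hdy hx hy).mul (hG.hdy hx hy)).deriv
  congr F G h := dy_congr h

lemma Sm.comm (hF : Sm X D F) {x y : ℝ} (hx : x ∈ Ioo 0 X) (hy : y ∈ Ioo 0 D) :
    Ole.dx (Ole.dy F) x y = Ole.dy (Ole.dx F) x y := by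
  set g : ℝ × ℝ → ℝ := fun z => F z.1 z.2
  have hd : ∀ᶠ z in 𝓝 (x, y), DifferentiableAt ℝ g z := by
    filter_upwards [nhdU hx hy] with z hz
    exact hF.differentiableAt hz.1 hz.2
  have hc : ContDiffAt ℝ (⊤ : ℕ∞) (fderiv ℝ g) (x, y) :=
    (hF.contDiffAt hx hy).fderiv_right (by simp)
  have hs : IsSymmSndFDerivAt ℝ g (x, y) :=
    (hF.contDiffAt hx hy).isSymmSndFDerivAt (by
      simp only [minSmoothness_of_isRCLikeNormedField]; 
      exact WithTop.coe_le_coe.2 (le_top : (2 : ℕ∞) ≤ ⊤))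
  have hdd : DifferentiableAt ℝ (fderiv ℝ g) (x, y) := hc.differentiableAt (by simp)
  have key : ∀ e e' : ℝ × ℝ, fderiv ℝ (fun z => fderiv ℝ g z e) (x, y) e'
      = fderiv ℝ (fderiv ℝ g) (x, y) e' e := by
    intro e e'
    have := (hdd.hasFDerivAt.clm_apply (hasFDerivAt_const e (x, y))).fderiv
    rw [this]; simp
  rw [hF.dy.dx_eq hx hy, hF.dx.dy_eq hx hy]
  have e1 : (fun z : ℝ × ℝ => Ole.dy F z.1 z.2) =ᶠ[𝓝 (x, y)] fun z => fderiv ℝ g z (0, 1) := by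
    filter_upwards [nhdU hx hy] with z hz
    exact hF.dy_eq hz.1 hz.2
  have e2 : (fun z : ℝ × ℝ => Ole.dx F z.1 z.2) =ᶠ[𝓝 (x, y)] fun z => fderiv ℝ g z (1, 0) := by
    filter_upwards [nhdU hx hy] with z hz
    exact hF.dx_eq hz.1 hz.2
  rw [e1.fderiv_eq, e2.fderiv_eq, key, key]
  exact hs _ _

/-- bounded on compact pieces -/
lemma Sm.bounded (hF : Sm X D F) {e s t : ℝ} (he : 0 < e) (hs : 0 < s) (ht : t < D) :
    ∃ C, 0 ≤ C ∧ ∀ x ∈ Ico e X, ∀ y ∈ Icc s t, |F x y| ≤ C := by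
  obtain ⟨g, hg, hFg⟩ := hF
  have hsub : Icc e X ×ˢ Icc s t ⊆ Ioc 0 X ×ˢ Ioo 0 D := by
    rintro ⟨x, y⟩ ⟨hx, hy⟩
    exact ⟨⟨he.trans_le hx.1, hx.2⟩, ⟨hs.trans_le hy.1, hy.2.trans_lt ht⟩⟩
  obtain ⟨C, hC⟩ := (isCompact_Icc.prod isCompact_Icc).exists_bound_of_continuousOn
    (hg.continuousOn.mono hsub)
  refine ⟨max C 0, le_max_right _ _, fun x hx y hy => ?_⟩
  rw [hFg x ⟨he.trans_le hx.1, hx.2⟩ y ⟨hs.trans_le hy.1, hy.2.trans_lt ht⟩]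
  exact (hC (x, y) ⟨⟨hx.1, hx.2.le⟩, hy⟩).trans (le_max_left _ _)

/-- extension version: ψ-derivative of a function smooth up to `x = X`. -/
lemma contDiffOn_dy (hF : ContDiffOn ℝ (⊤ : ℕ∞) (fun z : ℝ × ℝ => F z.1 z.2)
      (Ioc 0 X ×ˢ Ioo 0 D)) :
    ContDiffOn ℝ (⊤ : ℕ∞) (fun z : ℝ × ℝ => dy F z.1 z.2) (Ioc 0 X ×ˢ Ioo 0 D) := by
  have h1 := (hF.fderivWithin uniqS (m := (⊤ : ℕ∞)) (by simp)).clm_apply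
    (contDiffOn_const (c := ((0 : ℝ), (1 : ℝ))))
  refine h1.congr ?_
  rintro ⟨x, y⟩ ⟨hx, hy⟩
  have hd := (hF.differentiableOn (by simp) (x, y) ⟨hx, hy⟩).hasFDerivWithinAt
  have h2 : HasDerivWithinAt (fun y' : ℝ => (x, y')) ((0 : ℝ), (1 : ℝ)) (Ioo 0 D) y :=
    ((hasDerivAt_const y x).prodMk (hasDerivAt_id y)).hasDerivWithinAt
  have h3 := hd.comp_hasDerivWithinAt y h2 (fun y' hy' => ⟨hx, hy'⟩)
  exact (h3.hasDerivAt (isOpen_Ioo.mem_nhds hy)).deriv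

/-- second derivative at a local max -/
lemma second_deriv_nonpos {f f' : ℝ → ℝ} {c y : ℝ} (hm : IsLocalMax f y)
    (h1 : ∀ᶠ z in 𝓝 y, HasDerivAt f (f' z) z) (h2 : HasDerivAt f' c y) : c ≤ 0 := by
  by_contra hc
  push Not at hc
  have e1 : deriv f =ᶠ[𝓝 y] f' := h1.mono fun z hz => hz.deriv
  have e2 : deriv (deriv f) y = c := by rw [e1.deriv_eq, h2.deriv]
  have hmin : IsLocalMin f y :=
    isLocalMin_of_deriv_deriv_pos (by rw [e2]; exact hc) hm.deriv_eq_zero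
      h1.self_of_nhds.continuousAt
  have hconst : f =ᶠ[𝓝 y] fun _ => f y := by
    filter_upwards [hm, hmin] with z h3 h4
    exact le_antisymm h3 h4
  have e3 : deriv f =ᶠ[𝓝 y] fun _ => 0 := by
    have := hconst.deriv
    simpa using this
  have : deriv (deriv f) y = 0 := by rw [e3.deriv_eq]; simp
  linarith

lemma deriv_nonneg_of_max_left {f : ℝ → ℝ} {c a x : ℝ} (hax : a < x)
    (hm : ∀ z ∈ Icc a x, f z ≤ f x) (h : HasDerivAt f c x) : 0 ≤ c := by
  by_contra hc
  push Not at hc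
  have h1 : ∀ᶠ z in 𝓝[<] x, slope f x z < 0 :=
    ((hasDerivAt_iff_tendsto_slope.1 h).mono_left (nhdsLT_le_nhdsNE x)).eventually
      (gt_mem_nhds hc)
  have h2 : ∀ᶠ z in 𝓝[<] x, z ∈ Ioo a x := Ioo_mem_nhdsLT hax
  obtain ⟨z, hz1, hz2⟩ := (h1.and h2).exists
  rw [slope_def_field] at hz1
  have h3 := hm z ⟨hz2.1.le, hz2.2.le⟩
  have : 0 ≤ (f z - f x) / (z - x) :=
    div_nonneg_of_nonpos (by linarith) (by linarith [hz2.2])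
  linarith

/-- Maximum principle skeleton. -/
lemma max_principle {Φ Φx Φy Φyy : ℝ → ℝ → ℝ} {a b s t : ℝ}
    (hcont : ContinuousOn (fun z : ℝ × ℝ => Φ z.1 z.2) (Icc a b ×ˢ Icc s t))
    (h1 : ∀ x ∈ Ioc a b, ∀ y ∈ Ioo s t, HasDerivAt (fun x' => Φ x' y) (Φx x y) x)
    (h2 : ∀ x ∈ Ioc a b, ∀ y ∈ Ioo s t, HasDerivAt (Φ x) (Φy x y) y)
    (h3 : ∀ x ∈ Ioc a b, ∀ y ∈ Ioo s t, HasDerivAt (Φy x) (Φyy x y) y)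
    (hb0 : ∀ y ∈ Icc s t, Φ a y ≤ 0)
    (hbs : ∀ x ∈ Icc a b, Φ x s ≤ 0) (hbt : ∀ x ∈ Icc a b, Φ x t ≤ 0)
    (hint : ∀ x ∈ Ioc a b, ∀ y ∈ Ioo s t, 0 < Φ x y → 0 ≤ Φx x y → Φyy x y ≤ 0 → False) :
    ∀ x ∈ Icc a b, ∀ y ∈ Icc s t, Φ x y ≤ 0 := by
  intro x₀ hx₀ y₀ hy₀
  by_contra hpos
  push Not at hpos
  obtain ⟨⟨x, y⟩, ⟨hx, hy⟩, hmax⟩ := (isCompact_Icc.prod isCompact_Icc).exists_isMaxOn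
    ⟨(x₀, y₀), hx₀, hy₀⟩ hcont
  simp only at hx hy
  have hmax' : ∀ x' ∈ Icc a b, ∀ y' ∈ Icc s t, Φ x' y' ≤ Φ x y :=
    fun x' hx' y' hy' => hmax (show (x', y') ∈ _ from ⟨hx', hy'⟩)
  have hp : 0 < Φ x y := hpos.trans_le (hmax' _ hx₀ _ hy₀)
  have hxa : a < x := by
    rcases hx.1.eq_or_lt with h | h
    · subst h; linarith [hb0 y hy]
    · exact h
  have hys : s < y := by
    rcases hy.1.eq_or_lt with h | h
    · subst h; linarith [hbs x hx]
    · exact h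
  have hyt : y < t := by
    rcases hy.2.eq_or_lt with h | h
    · subst h; linarith [hbt x hx]
    · exact h
  have hxx : x ∈ Ioc a b := ⟨hxa, hx.2⟩
  have hyy : y ∈ Ioo s t := ⟨hys, hyt⟩
  refine hint x hxx y hyy hp ?_ ?_
  · exact deriv_nonneg_of_max_left hxa
      (fun z hz => hmax' z ⟨hz.1, hz.2.trans hx.2⟩ y hy) (h1 x hxx y hyy)
  · refine second_deriv_nonpos (f := Φ x) (f' := Φy x) ?_ ?_ (h3 x hxx y hyy)
    · filter_upwards [isOpen_Ioo.mem_nhds hyy] with z hz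
      exact hmax' x hx z ⟨hz.1.le, hz.2.le⟩
    · filter_upwards [isOpen_Ioo.mem_nhds hyy] with z hz
      exact h2 x hxx z hz

/-- bound at the endpoint -/
lemma endpoint_bound {f : ℝ → ℝ} {a b B : ℝ} (hab : a < b) (hB : 0 ≤ B) (k : ℕ)
    (hf : ContinuousWithinAt f (Iio b) b)
    (hd : ∀ x ∈ Ico a b, ∀ j, DifferentiableAt ℝ (iteratedDeriv j f) x)
    (h : ∀ x ∈ Ico a b, |iteratedDeriv k f x| ≤ B) : |iteratedDeriv k f b| ≤ B := by
  cases k with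
  | zero =>
    simp only [iteratedDeriv_zero] at *
    refine le_of_tendsto hf.tendsto.abs ?_
    filter_upwards [Ico_mem_nhdsLT hab] with z hz using h z hz
  | succ k =>
    rw [iteratedDeriv_succ] at *
    set g := iteratedDeriv k f
    by_cases hg : DifferentiableAt ℝ g b
    · have hga := hg.hasDerivAt
      have hs := ((hasDerivAt_iff_tendsto_slope.1 hga).mono_left (nhdsLT_le_nhdsNE b)).abs
      refine le_of_tendsto hs ?_
      filter_upwards [Ico_mem_nhdsLT hab] with z hz
      rw [slope_def_field, abs_div, div_le_iff₀ (abs_pos.2 (by linarith [hz.2]))]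
      have key := fun (u v : ℝ) => Convex.norm_image_sub_le_of_norm_hasDerivWithin_le (f := g) (f' := deriv g)
        (s := Ico a b) (C := B) (x := u) (y := v) (fun x hx => (hd x hx k).hasDerivAt.hasDerivWithinAt) h
        (convex_Ico a b) 
      have hlim : Tendsto (fun u => |g z - g u|) (𝓝[<] b) (𝓝 |g z - g b|) :=
        (tendsto_const_nhds.sub (hg.continuousAt.tendsto.mono_left nhdsWithin_le_nhds)).abs
      have hlim2 : Tendsto (fun u => B * |z - u|) (𝓝[<] b) (𝓝 (B * |z - b|)) :=
        ((tendsto_const_nhds.sub (tendsto_id.mono_left nhdsWithin_le_nhds)).abs).const_mul B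
      refine le_of_tendsto_of_tendsto hlim hlim2 ?_
      filter_upwards [Ico_mem_nhdsLT hab] with u hu
      exact key u z hu hz
    · rw [deriv_zero_of_not_differentiableAt hg]; simpa using hB

end Ole

open Set
set_option linter.unusedVariables false
set_option linter.unusedSectionVars false
namespace Ole
open Filter Topology

/-- weighted bound, locally uniform in `x > 0` -/
def BdM (X δ : ℝ) (f : ℝ → ℝ → ℝ) (d : ℝ) (μ : ℝ → ℝ → ℝ) : Prop :=
  ∀ ε > 0, ∃ C, 0 ≤ C ∧ ∀ x ∈ Ico ε X, ∀ y ∈ Ioc 0 δ, |f x y| ≤ C * y ^ d * μ x y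

abbrev Bd (X δ : ℝ) (f : ℝ → ℝ → ℝ) (d : ℝ) : Prop := BdM X δ f d (fun _ _ => 1)

section bd
variable {X D δ : ℝ} {f g : ℝ → ℝ → ℝ} {d e : ℝ} {μ ν : ℝ → ℝ → ℝ}

lemma Bd.get (h : Bd X δ f d) {ε : ℝ} (hε : 0 < ε) :
    ∃ C, 0 ≤ C ∧ ∀ x ∈ Ico ε X, ∀ y ∈ Ioc 0 δ, |f x y| ≤ C * y ^ d := by
  obtain ⟨C, hC, h⟩ := h ε hε
  exact ⟨C, hC, fun x hx y hy => by simpa using h x hx y hy⟩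

lemma Bd.mk (h : ∀ ε > 0, ∃ C, 0 ≤ C ∧ ∀ x ∈ Ico ε X, ∀ y ∈ Ioc 0 δ, |f x y| ≤ C * y ^ d) :
    Bd X δ f d := by
  intro ε hε
  obtain ⟨C, hC, h⟩ := h ε hε
  exact ⟨C, hC, fun x hx y hy => by simpa using h x hx y hy⟩

lemma BdM.congr (h : BdM X δ f d μ) (hδ : δ < D)
    (hfg : ∀ x ∈ Ioo 0 X, ∀ y ∈ Ioo 0 D, f x y = g x y) : BdM X δ g d μ := by
  intro ε hε
  obtain ⟨C, hC, h⟩ := h ε hε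
  refine ⟨C, hC, fun x hx y hy => ?_⟩
  rw [← hfg x ⟨hε.trans_le hx.1, hx.2⟩ y ⟨hy.1, hy.2.trans_lt hδ⟩]
  exact h x hx y hy

lemma BdM.add (hf : BdM X δ f d μ) (hg : BdM X δ g d μ) :
    BdM X δ (fun x y => f x y + g x y) d μ := by
  intro ε hε
  obtain ⟨C, hC, hf⟩ := hf ε hε
  obtain ⟨C', hC', hg⟩ := hg ε hε
  refine ⟨C + C', by positivity, fun x hx y hy => ?_⟩
  calc |f x y + g x y| ≤ |f x y| + |g x y| := abs_add_le _ _
    _ ≤ _ := by have := hf x hx y hy; have := hg x hx y hy; linarith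

lemma Bd.mulM (hf : Bd X δ f d) (hg : BdM X δ g e μ) :
    BdM X δ (fun x y => f x y * g x y) (d + e) μ := by
  intro ε hε
  obtain ⟨C, hC, hf⟩ := hf.get hε
  obtain ⟨C', hC', hg⟩ := hg ε hε
  refine ⟨C * C', by positivity, fun x hx y hy => ?_⟩
  have hy0 := hy.1
  rw [abs_mul, Real.rpow_add hy.1]
  calc |f x y| * |g x y| ≤ (C * y ^ d) * (C' * y ^ e * μ x y) :=
        mul_le_mul (hf x hx y hy) (hg x hx y hy) (abs_nonneg _) (by positivity)
    _ = _ := by ring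

lemma BdM.mulB (hf : BdM X δ f d μ) (hg : Bd X δ g e) :
    BdM X δ (fun x y => f x y * g x y) (d + e) μ := by
  have := hg.mulM hf
  rw [add_comm d e]
  simpa only [mul_comm] using this

lemma BdM.weaken (hδ : δ ≤ 1) (hf : BdM X δ f d μ) (hed : e ≤ d) : BdM X δ f e μ := by
  intro ε hε
  obtain ⟨C, hC, hf⟩ := hf ε hε
  refine ⟨C, hC, fun x hx y hy => ?_⟩
  have h1 := hf x hx y hy
  have hy0 := hy.1
  have h2 : y ^ d = y ^ e * y ^ (d - e) := by rw [← Real.rpow_add hy.1]; ring_nf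
  have h3 : y ^ (d - e) ≤ 1 := Real.rpow_le_one hy0.le (hy.2.trans hδ) (by linarith)
  have h4 : 0 < y ^ (d - e) := Real.rpow_pos_of_pos hy0 _
  rw [h2] at h1
  have h5 : 0 ≤ C * y ^ e * μ x y := by
    by_contra h
    push Not at h
    have := mul_neg_of_neg_of_pos h h4
    have := abs_nonneg (f x y)
    nlinarith
  nlinarith

lemma BdM.monoM (hf : BdM X δ f d μ) (h : ∀ x ∈ Ioo 0 X, ∀ y ∈ Ioc 0 δ, μ x y ≤ ν x y) :
    BdM X δ f d ν := by
  intro ε hε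
  obtain ⟨C, hC, hf⟩ := hf ε hε
  refine ⟨C, hC, fun x hx y hy => (hf x hx y hy).trans ?_⟩
  have hy0 := hy.1
  exact mul_le_mul_of_nonneg_left (h x ⟨hε.trans_le hx.1, hx.2⟩ y hy) (by positivity)

/-- remove the multiplier when it is itself bounded -/
lemma BdM.toBd (hf : BdM X δ f d μ) (hμ : Bd X δ μ e) : Bd X δ f (d + e) := by
  apply Bd.mk
  intro ε hε
  obtain ⟨C, hC, hf⟩ := hf ε hε
  obtain ⟨C', hC', hg⟩ := hμ.get hε
  refine ⟨C * C', by positivity, fun x hx y hy => (hf x hx y hy).trans ?_⟩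
  have hy0 := hy.1
  rw [Real.rpow_add hy.1]
  calc _ ≤ C * y ^ d * (C' * y ^ e) :=
        mul_le_mul_of_nonneg_left ((le_abs_self _).trans (hg x hx y hy)) (by positivity)
    _ = _ := by ring

lemma Bd.coef {c : ℝ → ℝ} (hc : Continuous c) : Bd X δ (fun x _ => c x) 0 := by
  apply Bd.mk
  intro ε hε
  obtain ⟨C, hC⟩ := (isCompact_Icc (a := (0 : ℝ)) (b := X)).exists_bound_of_continuousOn
    hc.continuousOn
  refine ⟨max C 0, le_max_right _ _, fun x hx y hy => ?_⟩
  rw [Real.rpow_zero, mul_one]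
  exact (hC x ⟨hε.le.trans hx.1, hx.2.le⟩).trans (le_max_left _ _)

end bd

/-- graded algebra generated by `G` -/
inductive T (X D : ℝ) (G : (ℝ → ℝ → ℝ) → ℝ → Prop) : (ℝ → ℝ → ℝ) → ℝ → Prop
  | gen {f d} : G f d → T X D G f d
  | add {f g d} : T X D G f d → T X D G g d → T X D G (fun x y => f x y + g x y) d
  | mul {f g d e} : T X D G f d → T X D G g e → T X D G (fun x y => f x y * g x y) (d + e)
  | weaken {f d e} : T X D G f d → e ≤ d → T X D G f e
  | congr {f g d} : T X D G f d → (∀ x ∈ Ioo 0 X, ∀ y ∈ Ioo 0 D, f x y = g x y) → T X D G g d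

section T
variable {X D δ : ℝ} {G G' : (ℝ → ℝ → ℝ) → ℝ → Prop} {f : ℝ → ℝ → ℝ} {d e : ℝ}
  {μ : ℝ → ℝ → ℝ} {der : (ℝ → ℝ → ℝ) → ℝ → ℝ → ℝ}

lemma T.cast (h : T X D G f d) (hd : d = e) : T X D G f e := hd ▸ h

lemma T.sm (hG : ∀ f d, G f d → Sm X D f) (h : T X D G f d) : Sm X D f := by
  induction h with
  | gen h => exact hG _ _ h
  | add _ _ h1 h2 => exact h1.add h2
  | mul _ _ h1 h2 => exact h1.mul h2
  | weaken _ _ h => exact h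
  | congr _ h1 h => exact h.congr h1

lemma T.bd (hδ : δ ≤ 1) (hδD : δ < D) (hG : ∀ f d, G f d → Bd X δ f d) (h : T X D G f d) :
    Bd X δ f d := by
  induction h with
  | gen h => exact hG _ _ h
  | add _ _ h1 h2 => exact h1.add h2
  | mul _ _ h1 h2 => exact h1.mulM h2
  | weaken _ h1 h => exact h.weaken hδ h1
  | congr _ h1 h => exact h.congr hδD h1

lemma T.mono (hG : ∀ f d, G f d → G' f d) (h : T X D G f d) : T X D G' f d := by
  induction h with
  | gen h => exact .gen (hG _ _ h)
  | add _ _ h1 h2 => exact h1.add h2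
  | mul _ _ h1 h2 => exact h1.mul h2
  | weaken _ h1 h => exact h.weaken h1
  | congr _ h1 h => exact h.congr h1

lemma T.isDer (hder : IsDer X D der) (hS : ∀ f d, G f d → Sm X D f) (hG : ∀ f d, G f d → G' f d)
    (hd : ∀ f d, G f d → T X D G' (der f) (d - e)) (h : T X D G f d) :
    T X D G' (der f) (d - e) := by
  induction h with
  | gen h => exact hd _ _ h
  | add a b h1 h2 =>
    exact (h1.add h2).congr fun x hx y hy => (hder.add _ _ (a.sm hS) (b.sm hS) x hx y hy).symm
  | mul a b h1 h2 =>
    refine (T.add ((h1.mul (b.mono hG)).cast ?_) (((a.mono hG).mul h2).cast ?_)).congr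
      fun x hx y hy => (hder.mul _ _ (a.sm hS) (b.sm hS) x hx y hy).symm
    · ring
    · ring
  | weaken _ h1 h => exact h.weaken (by linarith)
  | congr _ h1 h => exact h.congr (hder.congr _ _ h1)

lemma T.isDerM (hδ : δ ≤ 1) (hδD : δ < D) (hder : IsDer X D der) (hS : ∀ f d, G f d → Sm X D f)
    (hB : ∀ f d, G f d → Bd X δ f d)
    (hd : ∀ f d, G f d → BdM X δ (der f) (d - e) μ) (h : T X D G f d) :
    BdM X δ (der f) (d - e) μ := by
  induction h with
  | gen h => exact hd _ _ h
  | add a b h1 h2 =>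
    exact (h1.add h2).congr hδD fun x hx y hy =>
      (hder.add _ _ (a.sm hS) (b.sm hS) x hx y hy).symm
  | @mul _ _ d1 d2 a b h1 h2 =>
    have k1 := h1.mulB (b.bd hδ hδD hB)
    have k2 := (a.bd hδ hδD hB).mulM h2
    rw [show d1 - e + d2 = d1 + d2 - e by ring] at k1
    rw [show d1 + (d2 - e) = d1 + d2 - e by ring] at k2
    exact (k1.add k2).congr hδD fun x hx y hy =>
      (hder.mul _ _ (a.sm hS) (b.sm hS) x hx y hy).symm
  | weaken _ h1 h => exact h.weaken hδ (by linarith)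
  | congr _ h1 h => exact h.congr hδD (hder.congr _ _ h1)
end T

noncomputable def vv (w : ℝ → ℝ → ℝ) : ℕ → ℝ → ℝ → ℝ
  | 0 => w
  | k + 1 => dx (vv w k)

inductive Gn (w : ℝ → ℝ → ℝ) (K : ℕ → Prop) (b : Prop) : (ℝ → ℝ → ℝ) → ℝ → Prop
  | coef {c : ℝ → ℝ} : ContDiff ℝ (⊤ : ℕ∞) c → Gn w K b (fun x _ => c x) 0
  | wpow (s : ℝ) : Gn w K b (fun x y => w x y ^ s) s
  | v {j} : K j → Gn w K b (vv w j) 1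
  | dyv {j} : b → Gn w K b (dy (vv w j)) 0

structure Ctx (X D : ℝ) (q : ℝ → ℝ) (w : ℝ → ℝ → ℝ) (m M : ℝ) : Prop where
  hX : 0 < X
  hD : 0 < D
  hD1 : D < 1
  hq : ContDiff ℝ (⊤ : ℕ∞) q
  hq0 : ∀ x, 0 ≤ q x
  hm : 0 < m
  hM : 0 < M
  smooth : ContDiffOn ℝ (⊤ : ℕ∞) (fun z : ℝ × ℝ => w z.1 z.2) (Ioc 0 X ×ˢ Ioo 0 D)
  lb : ∀ x ∈ Ioc 0 X, ∀ y ∈ Ioo 0 D, m * y ≤ w x y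
  ub : ∀ x ∈ Ioc 0 X, ∀ y ∈ Ioo 0 D, w x y ≤ M * y
  eqn : ∀ x ∈ Ioo 0 X, ∀ y ∈ Ioo 0 D, dy (dy w) x y = (dx w x y - q x) * w x y ^ (-(1 / 2) : ℝ)
  v1 : ∃ C, 0 ≤ C ∧ ∀ x ∈ Ioo 0 X, ∀ y ∈ Ioo 0 D, |dx w x y| ≤ C * y ^ (1 / 2 : ℝ)

namespace Ctx
variable {X D m M : ℝ} {q : ℝ → ℝ} {w : ℝ → ℝ → ℝ} (H : Ctx X D q w m M)
include H

lemma hδ1 : D / 2 ≤ 1 := by linarith [H.hD1, H.hD]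
lemma hδD : D / 2 < D := by linarith [H.hD]
lemma hδ0 : 0 < D / 2 := by linarith [H.hD]

lemma wpos' {x y : ℝ} (hx : x ∈ Ioc 0 X) (hy : y ∈ Ioo 0 D) : 0 < w x y :=
  (mul_pos H.hm hy.1).trans_le (H.lb x hx y hy)

lemma wpos {x y : ℝ} (hx : x ∈ Ioo 0 X) (hy : y ∈ Ioo 0 D) : 0 < w x y :=
  H.wpos' ⟨hx.1, hx.2.le⟩ hy

lemma sm_w : Sm X D w := ⟨_, H.smooth, fun _ _ _ _ => rfl⟩

lemma sm_v (k : ℕ) : Sm X D (vv w k) := by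
  induction k with
  | zero => exact H.sm_w
  | succ k ih => exact ih.dx

lemma sm_wpow (s : ℝ) : Sm X D (fun x y => w x y ^ s) :=
  ⟨fun z => w z.1 z.2 ^ s, H.smooth.rpow_const_of_ne fun z hz => (H.wpos' hz.1 hz.2).ne',
    fun _ _ _ _ => rfl⟩

lemma gn_sm {K : ℕ → Prop} {b : Prop} : ∀ f d, Gn w K b f d → Sm X D f := by
  intro f d h
  cases h with
  | coef hc => exact Sm.coef hc
  | wpow s => exact H.sm_wpow _
  | v _ => exact H.sm_v _
  | dyv _ => exact (H.sm_v _).dy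

lemma bd_wpow (s : ℝ) : Bd X (D / 2) (fun x y => w x y ^ s) s := by
  apply Bd.mk
  intro ε hε
  refine ⟨max (m ^ s) (M ^ s), (Real.rpow_nonneg H.hm.le s).trans (le_max_left _ _), ?_⟩
  intro x hx y hy
  have hx' : x ∈ Ioc 0 X := ⟨hε.trans_le hx.1, hx.2.le⟩
  have hy' : y ∈ Ioo 0 D := ⟨hy.1, hy.2.trans_lt H.hδD⟩
  have hp := H.wpos' hx' hy'
  have hy0 := hy.1
  rw [abs_of_nonneg (Real.rpow_nonneg hp.le s)]
  rcases le_total 0 s with hs | hs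
  · calc w x y ^ s ≤ (M * y) ^ s := Real.rpow_le_rpow hp.le (H.ub x hx' y hy') hs
      _ = M ^ s * y ^ s := Real.mul_rpow H.hM.le hy.1.le
      _ ≤ _ := by gcongr; exact le_max_right _ _
  · calc w x y ^ s ≤ (m * y) ^ s :=
          Real.rpow_le_rpow_of_nonpos (mul_pos H.hm hy.1) (H.lb x hx' y hy') hs
      _ = m ^ s * y ^ s := Real.mul_rpow H.hm.le hy.1.le
      _ ≤ _ := by gcongr; exact le_max_left _ _

lemma gn_bd {K : ℕ → Prop} {b : Prop} (hK : ∀ j, K j → Bd X (D / 2) (vv w j) 1)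
    (hb : b → ∀ j, Bd X (D / 2) (dy (vv w j)) 0) :
    ∀ f d, Gn w K b f d → Bd X (D / 2) f d := by
  intro f d h
  cases h with
  | coef hc => exact Bd.coef hc.continuous
  | wpow s => exact H.bd_wpow _
  | v h => exact hK _ h
  | dyv h => exact hb h _

lemma dx_wpow (s : ℝ) {x y : ℝ} (hx : x ∈ Ioo 0 X) (hy : y ∈ Ioo 0 D) :
    dx (fun x y => w x y ^ s) x y = s * w x y ^ (s - 1) * vv w 1 x y := by
  have h := (H.sm_w.hdx hx hy).rpow_const (p := s) (Or.inl (H.wpos hx hy).ne')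
  refine h.deriv.trans ?_
  show _ = s * w x y ^ (s - 1) * dx w x y
  ring

lemma dy_wpow (s : ℝ) {x y : ℝ} (hx : x ∈ Ioo 0 X) (hy : y ∈ Ioo 0 D) :
    dy (fun x y => w x y ^ s) x y = s * w x y ^ (s - 1) * dy w x y := by
  have h := (H.sm_w.hdy hx hy).rpow_const (p := s) (Or.inl (H.wpos hx hy).ne')
  refine h.deriv.trans ?_
  ring

lemma dx_coef (c : ℝ → ℝ) : dx (fun x _ => c x) = fun x _ => deriv c x := rfl
lemma dy_coef (c : ℝ → ℝ) : dy (fun x _ => c x) = fun x _ => (fun _ => (0 : ℝ)) x := by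
  funext x y; simp [dy]

lemma contDiff_deriv {c : ℝ → ℝ} (hc : ContDiff ℝ (⊤ : ℕ∞) c) :
    ContDiff ℝ (⊤ : ℕ∞) (deriv c) := (contDiff_infty_iff_deriv.1 hc).2

end Ctx

section Tops
variable {X D : ℝ} {w : ℝ → ℝ → ℝ} {K : ℕ → Prop} {b : Prop} {f : ℝ → ℝ → ℝ} {d : ℝ}

lemma T.coef {c : ℝ → ℝ} (hc : ContDiff ℝ (⊤ : ℕ∞) c) : T X D (Gn w K b) (fun x _ => c x) 0 :=
  .gen (.coef hc)

lemma T.smul (c : ℝ) (h : T X D (Gn w K b) f d) : T X D (Gn w K b) (fun x y => c * f x y) d :=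
  ((T.coef (contDiff_const (c := c))).mul h).cast (by ring)

end Tops

namespace Ctx
variable {X D m M : ℝ} {q : ℝ → ℝ} {w : ℝ → ℝ → ℝ} (H : Ctx X D q w m M)
include H

/-- `∂ₓ` acts on the algebra, raising the order. -/
lemma T_dx {k : ℕ} {f : ℝ → ℝ → ℝ} {d : ℝ} (h : T X D (Gn w (· ≤ k) False) f d) :
    T X D (Gn w (· ≤ k + 1) False) (dx f) d := by
  have := T.isDer (G' := Gn w (· ≤ k + 1) False) (e := 0) isDer_dx H.gn_sm ?_ ?_ h
  · exact this.cast (by ring)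
  · intro f d h
    cases h with
    | coef hc => exact .coef hc
    | wpow s => exact .wpow _
    | v h => exact .v (Nat.le_succ_of_le h)
    | dyv h => exact h.elim
  · intro f d h
    cases h with
    | coef hc => exact (T.coef (H.contDiff_deriv hc)).cast (by ring)
    | wpow s =>
      refine ((((T.gen (.wpow (d - 1))).smul d).mul (T.gen (.v (j := 1) (by simp)))).cast
        (by ring)).congr fun x hx y hy => (H.dx_wpow d hx hy).symm
    | @v j h => exact (T.gen (.v (j := j + 1) (by simpa using h))).cast (by ring)
    | dyv h => exact h.elim

/-- the second derivative -/
lemma eqn_v (k : ℕ) : ∃ F, T X D (Gn w (· ≤ k + 1) False) F (-(1 / 2)) ∧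
    ∀ x ∈ Ioo 0 X, ∀ y ∈ Ioo 0 D, dy (dy (vv w k)) x y = F x y := by
  induction k with
  | zero =>
    refine ⟨fun x y => (vv w 1 x y + (-1) * q x) * w x y ^ (-(1 / 2) : ℝ), ?_, ?_⟩
    · refine ((T.add ((T.gen (.v (by simp))).weaken zero_le_one)
        ((T.coef H.hq).smul (-1))).mul (.gen (.wpow _))).cast (by ring)
    · intro x hx y hy
      rw [show vv w 0 = w from rfl, H.eqn x hx y hy]
      show _ = (dx w x y + _) * _
      ring
  | succ k ih =>
    obtain ⟨F, hF, hE⟩ := ih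
    refine ⟨dx F, H.T_dx hF, fun x hx y hy => ?_⟩
    rw [← dx_congr hE x hx y hy, (H.sm_v k).dy.comm hx hy]
    exact (dy_congr (fun x hx y hy => (H.sm_v k).comm hx hy) x hx y hy).symm

/-- one differentiation of the structured equation -/
lemma struct_step {n : ℕ} {P Q : ℝ → ℝ → ℝ} (hP : Sm X D P) (hQ : Sm X D Q)
    (hE : ∀ x ∈ Ioo 0 X, ∀ y ∈ Ioo 0 D, dy (dy (vv w (n + 1))) x y =
      w x y ^ (-(1 / 2) : ℝ) * vv w (n + 2) x y
      + 1 / 2 * (q x * w x y ^ (-(3 / 2) : ℝ)) * vv w (n + 1) x y + (P x y + Q x y)) :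
    ∀ x ∈ Ioo 0 X, ∀ y ∈ Ioo 0 D, dy (dy (vv w (n + 2))) x y =
      w x y ^ (-(1 / 2) : ℝ) * vv w (n + 3) x y
      + 1 / 2 * (q x * w x y ^ (-(3 / 2) : ℝ)) * vv w (n + 2) x y
      + ((dx P x y + (-(1 / 2)) * (w x y ^ (-(3 / 2) : ℝ) * (vv w 1 x y * vv w (n + 2) x y)))
        + (dx Q x y + (1 / 2 * (deriv q x * w x y ^ (-(3 / 2) : ℝ))
          + (-(3 / 4)) * (q x * (w x y ^ (-(5 / 2) : ℝ) * vv w 1 x y))) * vv w (n + 1) x y)) := by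
  intro x hx y hy
  have e1 : dy (dy (vv w (n + 2))) x y = dx (dy (dy (vv w (n + 1)))) x y := by
    rw [(H.sm_v (n + 1)).dy.comm hx hy]
    exact (dy_congr (fun x hx y hy => (H.sm_v (n + 1)).comm hx hy) x hx y hy).symm
  rw [e1, dx_congr hE x hx y hy]
  have a1 := (H.sm_wpow (-(1 / 2))).hdx hx hy
  have a2 := (H.sm_wpow (-(3 / 2))).hdx hx hy
  rw [H.dx_wpow _ hx hy] at a1 a2
  have a3 := (H.sm_v (n + 2)).hdx hx hy
  have a4 := (H.sm_v (n + 1)).hdx hx hy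
  have a5 : HasDerivAt q (deriv q x) x := (H.hq.differentiable (by simp) x).hasDerivAt
  have a6 := ((a1.mul a3).add ((((a5.mul a2).const_mul (1 / 2))).mul a4)).add
    ((hP.hdx hx hy).add (hQ.hdx hx hy))
  refine a6.deriv.trans ?_
  rw [show dx (vv w (n + 2)) x y = vv w (n + 3) x y from rfl,
    show dx (vv w (n + 1)) x y = vv w (n + 2) x y from rfl,
    show (-(1 / 2) - 1 : ℝ) = -(3 / 2) by norm_num,
    show (-(3 / 2) - 1 : ℝ) = -(5 / 2) by norm_num]
  simp only [Pi.mul_apply]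
  ring

/-- the equation for the first derivative -/
lemma struct_one : ∀ x ∈ Ioo 0 X, ∀ y ∈ Ioo 0 D, dy (dy (vv w 1)) x y =
      w x y ^ (-(1 / 2) : ℝ) * vv w 2 x y
      + 1 / 2 * (q x * w x y ^ (-(3 / 2) : ℝ)) * vv w 1 x y
      + ((-(1 / 2)) * (w x y ^ (-(3 / 2) : ℝ) * (vv w 1 x y * vv w 1 x y))
        + (-1) * (deriv q x * w x y ^ (-(1 / 2) : ℝ))) := by
  intro x hx y hy
  have e1 : dy (dy (vv w 1)) x y = dx (dy (dy w)) x y := by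
    rw [H.sm_w.dy.comm hx hy]
    exact (dy_congr (fun x hx y hy => H.sm_w.comm hx hy) x hx y hy).symm
  rw [e1, dx_congr H.eqn x hx y hy]
  have a1 := (H.sm_wpow (-(1 / 2))).hdx hx hy
  rw [H.dx_wpow _ hx hy] at a1
  have a3 := (H.sm_v 1).hdx hx hy
  have a5 : HasDerivAt q (deriv q x) x := (H.hq.differentiable (by simp) x).hasDerivAt
  refine ((a3.sub a5).mul a1).deriv.trans ?_
  rw [show dx (vv w 1) x y = vv w 2 x y from rfl,
    show (-(1 / 2) - 1 : ℝ) = -(3 / 2) by norm_num]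
  show (_ - _) * _ + (vv w 1 x y - q x) * _ = _
  ring

/-- structure of the equation -/
lemma struct (n : ℕ) : ∃ P Q, T X D (Gn w (· ≤ n + 1) False) P (1 / 2) ∧
    T X D (Gn w (· ≤ n) False) Q (-(1 / 2)) ∧
    ∀ x ∈ Ioo 0 X, ∀ y ∈ Ioo 0 D, dy (dy (vv w (n + 1))) x y =
      w x y ^ (-(1 / 2) : ℝ) * vv w (n + 2) x y
      + 1 / 2 * (q x * w x y ^ (-(3 / 2) : ℝ)) * vv w (n + 1) x y + (P x y + Q x y) := by
  induction n with
  | zero =>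
    refine ⟨_, _, ?_, ?_, H.struct_one⟩
    · exact (((T.gen (.wpow _)).mul ((T.gen (.v (by simp))).mul
        (T.gen (.v (by simp))))).smul _).cast (by norm_num)
    · exact (((T.coef (H.contDiff_deriv H.hq)).mul (T.gen (.wpow _))).smul _).cast (by norm_num)
  | succ n ih =>
    obtain ⟨P, Q, hP, hQ, hE⟩ := ih
    refine ⟨_, _, ?_, ?_, H.struct_step (hP.sm H.gn_sm) (hQ.sm H.gn_sm) hE⟩
    · refine (H.T_dx hP).add ?_
      exact (((T.gen (.wpow _)).mul ((T.gen (.v (by simp))).mul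
        (T.gen (.v (by simp))))).smul _).cast (by norm_num)
    · refine (H.T_dx hQ).add ?_
      refine ((T.add ?_ ?_).mul (d := -(3 / 2)) (T.gen (.v (by simp)))).cast (by norm_num)
      · exact (((T.coef (H.contDiff_deriv H.hq)).mul (T.gen (.wpow _))).smul _).cast
          (by norm_num)
      · exact (((T.coef H.hq).mul ((T.gen (.wpow _)).mul (T.gen (.v (by simp))))).smul _).cast
          (by norm_num)

/-- `∂_ψ v_j` bounded -/
lemma bd_dyv {k : ℕ} (hk : ∀ j ≤ k, Bd X (D / 2) (vv w j) 1) {j : ℕ} (hj : j < k) :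
    Bd X (D / 2) (dy (vv w j)) 0 := by
  obtain ⟨F, hF, hE⟩ := H.eqn_v j
  have hFb : Bd X (D / 2) F (-(1 / 2)) := hF.bd H.hδ1 H.hδD
    (H.gn_bd (fun i hi => hk i (le_trans hi hj)) False.elim)
  apply Bd.mk
  intro ε hε
  obtain ⟨C, hC, hb⟩ := hFb.get hε
  obtain ⟨B, hB, hb2⟩ := (H.sm_v j).dy.bounded hε H.hδ0 H.hδD
  refine ⟨B + 2 * C, by positivity, fun x hx y hy => ?_⟩
  rw [Real.rpow_zero, mul_one]
  have hx' : x ∈ Ioo 0 X := ⟨hε.trans_le hx.1, hx.2⟩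
  have hsub : ∀ z ∈ Icc y (D / 2), z ∈ Ioo 0 D := fun z hz =>
    ⟨hy.1.trans_le hz.1, hz.2.trans_lt H.hδD⟩
  have hder : ∀ z ∈ Icc y (D / 2), HasDerivAt (dy (vv w j) x) (F x z) z := fun z hz => by
    rw [← hE x hx' z (hsub z hz)]
    exact (H.sm_v j).dy.hdy hx' (hsub z hz)
  have hder2 : ∀ z ∈ Icc y (D / 2), HasDerivAt (fun z : ℝ => 2 * C * z ^ (1 / 2 : ℝ))
      (C * z ^ (-(1 / 2) : ℝ)) z := fun z hz => by
    have := ((hasDerivAt_id z).rpow_const (p := 1 / 2) (Or.inl (hsub z hz).1.ne')).const_mul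
      (2 * C)
    refine this.congr_deriv ?_
    rw [show (1 / 2 - 1 : ℝ) = -(1 / 2) by norm_num]
    simp only [id]; ring
  have hyy : y ∈ Icc y (D / 2) := ⟨le_rfl, hy.2⟩
  have hyd : D / 2 ∈ Icc y (D / 2) := ⟨hy.2, le_rfl⟩
  have hfb : ∀ z ∈ Icc y (D / 2), |F x z| ≤ C * z ^ (-(1 / 2) : ℝ) := fun z hz =>
    hb x hx z ⟨(hsub z hz).1, hz.2⟩
  have m1 : MonotoneOn (fun z => 2 * C * z ^ (1 / 2 : ℝ) - dy (vv w j) x z) (Icc y (D / 2)) := by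
    refine monotoneOn_of_hasDerivWithinAt_nonneg (f' := fun z => C * z ^ (-(1 / 2) : ℝ) - F x z)
      (convex_Icc _ _)
      (fun z hz => ((hder2 z hz).sub (hder z hz)).continuousAt.continuousWithinAt)
      (fun z hz => ((hder2 z (interior_subset hz)).sub
        (hder z (interior_subset hz))).hasDerivWithinAt) ?_
    intro z hz
    have := (abs_le.1 (hfb z (interior_subset hz))).2
    linarith
  have m2 : MonotoneOn (fun z => 2 * C * z ^ (1 / 2 : ℝ) + dy (vv w j) x z) (Icc y (D / 2)) := by
    refine monotoneOn_of_hasDerivWithinAt_nonneg (f' := fun z => C * z ^ (-(1 / 2) : ℝ) + F x z)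
      (convex_Icc _ _)
      (fun z hz => ((hder2 z hz).add (hder z hz)).continuousAt.continuousWithinAt)
      (fun z hz => ((hder2 z (interior_subset hz)).add
        (hder z (interior_subset hz))).hasDerivWithinAt) ?_
    intro z hz
    have := (abs_le.1 (hfb z (interior_subset hz))).1
    linarith
  have k1 := m1 hyy hyd hy.2
  have k2 := m2 hyy hyd hy.2
  simp only at k1 k2
  have k3 := abs_le.1 (hb2 x hx (D / 2) ⟨le_rfl, le_rfl⟩)
  have k4 : (D / 2) ^ (1 / 2 : ℝ) ≤ 1 := Real.rpow_le_one H.hδ0.le H.hδ1 (by norm_num)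
  have k5 : 0 ≤ y ^ (1 / 2 : ℝ) := Real.rpow_nonneg hy.1.le _
  have k6 : 2 * C * (D / 2) ^ (1 / 2 : ℝ) ≤ 2 * C := by nlinarith
  have k7 : 0 ≤ 2 * C * y ^ (1 / 2 : ℝ) := by positivity
  rw [abs_le]
  constructor <;> linarith [k3.1, k3.2]

/-- `∂ₓ` of an element of order `≤ k` -/
lemma T_dxM {k : ℕ} (hk1 : 1 ≤ k) (hk : ∀ j ≤ k, Bd X (D / 2) (vv w j) 1) {f : ℝ → ℝ → ℝ} {d : ℝ}
    (h : T X D (Gn w (· ≤ k) False) f d) :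
    BdM X (D / 2) (dx f) d (fun x y => 1 + y⁻¹ * |vv w (k + 1) x y|) := by
  have hmu : ∀ x ∈ Ioo 0 X, ∀ y ∈ Ioc 0 (D / 2), (1 : ℝ) ≤ 1 + y⁻¹ * |vv w (k + 1) x y| := by
    intro x _ y hy
    have := mul_nonneg (inv_nonneg.2 hy.1.le) (abs_nonneg (vv w (k + 1) x y))
    linarith
  have := T.isDerM (e := 0) (μ := fun x y => 1 + y⁻¹ * |vv w (k + 1) x y|) H.hδ1 H.hδD
    isDer_dx H.gn_sm (H.gn_bd hk False.elim) ?_ h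
  · simpa using this
  intro f d h
  rw [sub_zero]
  cases h with
  | coef hc => exact BdM.monoM (Bd.coef (H.contDiff_deriv hc).continuous) hmu
  | wpow s =>
    refine BdM.monoM (BdM.congr (f := fun x y => d * w x y ^ (d - 1) * vv w 1 x y) ?_ H.hδD
      fun x hx y hy => (H.dx_wpow d hx hy).symm) hmu
    have := (T.mul ((T.gen (.wpow (w := w) (K := (· ≤ k)) (b := False) (d - 1))).smul d)
      (T.gen (.v (j := 1) hk1))).bd H.hδ1 H.hδD (X := X) (D := D) (H.gn_bd hk False.elim)
    simpa using this
  | @v j hj =>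
    rcases Nat.lt_or_ge j k with h | h
    · exact BdM.monoM (hk (j + 1) h) hmu
    · obtain rfl : j = k := le_antisymm hj h
      intro ε hε
      refine ⟨1, zero_le_one, fun x hx y hy => ?_⟩
      rw [Real.rpow_one]
      have hy0 := hy.1
      have : 1 * y * (1 + y⁻¹ * |vv w (j + 1) x y|) = y + |vv w (j + 1) x y| := by
        field_simp
      rw [this]
      show |vv w (j + 1) x y| ≤ _
      linarith
  | dyv h => exact h.elim

/-- `∂_ψ` of an element of order `≤ k` -/
lemma T_dyM {k : ℕ} (hk1 : 1 ≤ k) (hk : ∀ j ≤ k, Bd X (D / 2) (vv w j) 1) {f : ℝ → ℝ → ℝ} {d : ℝ}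
    (h : T X D (Gn w (· ≤ k) False) f d) :
    BdM X (D / 2) (dy f) (d - 1) (fun x y => 1 + |dy (vv w k) x y|) := by
  have hmu : ∀ x ∈ Ioo 0 X, ∀ y ∈ Ioc 0 (D / 2), (1 : ℝ) ≤ 1 + |dy (vv w k) x y| := by
    intro x _ y hy
    have := abs_nonneg (dy (vv w k) x y)
    linarith
  refine T.isDerM (e := 1) (μ := fun x y => 1 + |dy (vv w k) x y|) H.hδ1 H.hδD
    isDer_dy H.gn_sm (H.gn_bd hk False.elim) ?_ h
  intro f d h
  cases h with
  | coef hc =>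
    rw [H.dy_coef]
    exact BdM.monoM ((Bd.coef continuous_const).weaken H.hδ1 (by norm_num)) hmu
  | wpow s =>
    refine BdM.monoM (BdM.congr (f := fun x y => d * w x y ^ (d - 1) * dy w x y) ?_ H.hδD
      fun x hx y hy => (H.dy_wpow d hx hy).symm) hmu
    have h1 := ((T.gen (.wpow (w := w) (K := (· ≤ k)) (b := False) (d - 1))).smul d).bd
      H.hδ1 H.hδD (X := X) (D := D) (H.gn_bd hk False.elim)
    have h2 : Bd X (D / 2) (dy w) 0 := H.bd_dyv hk (j := 0) hk1
    have := h1.mulM h2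
    rwa [add_zero] at this
  | @v j hj =>
    rw [sub_self]
    rcases Nat.lt_or_ge j k with h | h
    · exact BdM.monoM (H.bd_dyv hk h) hmu
    · obtain rfl : j = k := le_antisymm hj h
      intro ε hε
      refine ⟨1, zero_le_one, fun x hx y hy => ?_⟩
      rw [Real.rpow_zero]
      linarith
  | dyv h => exact h.elim

end Ctx
end Ole

open Set
set_option linter.unusedVariables false
namespace Ole
open Filter Topology

lemma barrier_one {z zx zy zyy N c : ℝ → ℝ → ℝ} {g g' g'' e n : ℝ → ℝ} {a b s t : ℝ}
    (hcont : ContinuousOn (fun p : ℝ × ℝ => z p.1 p.2) (Icc a b ×ˢ Icc s t))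
    (h1 : ∀ x ∈ Ioc a b, ∀ y ∈ Ioo s t, HasDerivAt (fun x' => z x' y) (zx x y) x)
    (h2 : ∀ x ∈ Ioc a b, ∀ y ∈ Ioo s t, HasDerivAt (z x) (zy x y) y)
    (h3 : ∀ x ∈ Ioc a b, ∀ y ∈ Ioo s t, HasDerivAt (zy x) (zyy x y) y)
    (hg : ∀ y ∈ Icc s t, HasDerivAt g (g' y) y)
    (hg' : ∀ y ∈ Ioo s t, HasDerivAt g' (g'' y) y)
    (hg0 : ∀ y ∈ Icc s t, 0 ≤ g y)
    (hN : ∀ x ∈ Ioc a b, ∀ y ∈ Ioo s t, 0 ≤ N x y)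
    (hc : ∀ x ∈ Ioc a b, ∀ y ∈ Ioo s t, 0 ≤ c x y)
    (hE : ∀ x ∈ Ioc a b, ∀ y ∈ Ioo s t, |zyy x y - (N x y * zx x y + c x y * z x y)| ≤ e y)
    (hNz : ∀ x ∈ Ioc a b, ∀ y ∈ Ioo s t, N x y * |z x y| ≤ n y)
    (hgn : ∀ y ∈ Ioo s t, n y + (b - a) * e y < - g'' y)
    (hs : ∀ x ∈ Icc a b, (b - a) * |z x s| ≤ g s)
    (ht : ∀ x ∈ Icc a b, (b - a) * |z x t| ≤ g t) :
    ∀ x ∈ Icc a b, ∀ y ∈ Icc s t, (x - a) * z x y - g y ≤ 0 := by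
  have hbd : ∀ x ∈ Icc a b, ∀ r : ℝ, (x - a) * r ≤ (b - a) * |r| := by
    intro x hx r
    have := le_abs_self r
    have h0 := abs_nonneg r
    nlinarith [hx.1, hx.2]
  refine max_principle (Φ := fun x y => (x - a) * z x y - g y)
    (Φx := fun x y => 1 * z x y + (x - a) * zx x y) (Φy := fun x y => (x - a) * zy x y - g' y)
    (Φyy := fun x y => (x - a) * zyy x y - g'' y) ?_ ?_ ?_ ?_ ?_ ?_ ?_ ?_
  · refine ContinuousOn.sub (ContinuousOn.mul (by fun_prop) hcont) ?_
    exact (ContinuousOn.comp (g := g) (t := Icc s t)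
      (fun y hy => (hg y hy).continuousAt.continuousWithinAt) continuousOn_snd
      (fun p hp => hp.2))
  · intro x hx y hy
    exact ((((hasDerivAt_id x).sub_const a)).mul (h1 x hx y hy)).sub_const (g y)
  · intro x hx y hy
    exact ((h2 x hx y hy).const_mul _).sub (hg y (Ioo_subset_Icc_self hy))
  · intro x hx y hy
    exact ((h3 x hx y hy).const_mul _).sub (hg' y hy)
  · intro y hy
    have := hg0 y hy
    simp only [sub_self, zero_mul]
    linarith
  · intro x hx
    have := hbd x hx (z x s)
    linarith [hs x hx]
  · intro x hx
    have := hbd x hx (z x t)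
    linarith [ht x hx]
  · intro x hx y hy k1 k2 k3
    have hE1 := hE x hx y hy
    have hee : 0 ≤ e y := (abs_nonneg _).trans hE1
    have hN0 := hN x hx y hy
    have hc0 := hc x hx y hy
    have hn := hNz x hx y hy
    have hgn1 := hgn y hy
    have hg1 := hg0 y (Ioo_subset_Icc_self hy)
    have hE2 := (abs_le.1 hE1).1
    have hxa : 0 < x - a := by linarith [hx.1]
    have hxb : x - a ≤ b - a := by linarith [hx.2]
    have hz : 0 < (x - a) * z x y := by linarith
    have l1 : (x - a) * (N x y * zx x y + c x y * z x y - e y) ≤ (x - a) * zyy x y :=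
      mul_le_mul_of_nonneg_left (by linarith) hxa.le
    have l2 : 0 ≤ N x y * (1 * z x y + (x - a) * zx x y) := mul_nonneg hN0 k2
    have l3 : 0 ≤ c x y * ((x - a) * z x y) := mul_nonneg hc0 hz.le
    have l4 : N x y * z x y ≤ N x y * |z x y| := mul_le_mul_of_nonneg_left (le_abs_self _) hN0
    have l5 : (x - a) * e y ≤ (b - a) * e y := mul_le_mul_of_nonneg_right hxb hee
    nlinarith

lemma barrier {z zx zy zyy N c : ℝ → ℝ → ℝ} {g g' g'' e n : ℝ → ℝ} {a b s t : ℝ}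
    (hcont : ContinuousOn (fun p : ℝ × ℝ => z p.1 p.2) (Icc a b ×ˢ Icc s t))
    (h1 : ∀ x ∈ Ioc a b, ∀ y ∈ Ioo s t, HasDerivAt (fun x' => z x' y) (zx x y) x)
    (h2 : ∀ x ∈ Ioc a b, ∀ y ∈ Ioo s t, HasDerivAt (z x) (zy x y) y)
    (h3 : ∀ x ∈ Ioc a b, ∀ y ∈ Ioo s t, HasDerivAt (zy x) (zyy x y) y)
    (hg : ∀ y ∈ Icc s t, HasDerivAt g (g' y) y)
    (hg' : ∀ y ∈ Ioo s t, HasDerivAt g' (g'' y) y)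
    (hg0 : ∀ y ∈ Icc s t, 0 ≤ g y)
    (hN : ∀ x ∈ Ioc a b, ∀ y ∈ Ioo s t, 0 ≤ N x y)
    (hc : ∀ x ∈ Ioc a b, ∀ y ∈ Ioo s t, 0 ≤ c x y)
    (hE : ∀ x ∈ Ioc a b, ∀ y ∈ Ioo s t, |zyy x y - (N x y * zx x y + c x y * z x y)| ≤ e y)
    (hNz : ∀ x ∈ Ioc a b, ∀ y ∈ Ioo s t, N x y * |z x y| ≤ n y)
    (hgn : ∀ y ∈ Ioo s t, n y + (b - a) * e y < - g'' y)
    (hs : ∀ x ∈ Icc a b, (b - a) * |z x s| ≤ g s)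
    (ht : ∀ x ∈ Icc a b, (b - a) * |z x t| ≤ g t) :
    ∀ x ∈ Icc a b, ∀ y ∈ Icc s t, (x - a) * |z x y| ≤ g y := by
  intro x hx y hy
  have k1 := barrier_one hcont h1 h2 h3 hg hg' hg0 hN hc hE hNz hgn hs ht x hx y hy
  have k2 := barrier_one (z := fun x y => - z x y) (zx := fun x y => - zx x y)
    (zy := fun x y => - zy x y) (zyy := fun x y => - zyy x y) (N := N) (c := c) (g := g)
    (e := e) (n := n)
    hcont.neg (fun x hx y hy => (h1 x hx y hy).neg)
    (fun x hx y hy => (h2 x hx y hy).neg) (fun x hx y hy => (h3 x hx y hy).neg) hg hg' hg0 hN hc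
    (fun x hx y hy => by
      rw [← abs_neg]
      convert hE x hx y hy using 2
      ring) (fun x hx y hy => by simpa using hNz x hx y hy) hgn
      (by simpa using hs) (by simpa using ht) x hx y hy
  rcases abs_cases (z x y) with h | h <;> rw [h.1] <;> linarith

lemma Sm.contOn {X D : ℝ} {z : ℝ → ℝ → ℝ} (hz : Sm X D z) {a b s t : ℝ} (ha : 0 < a) (hb : b < X)
    (hs : 0 < s) (ht : t < D) :
    ContinuousOn (fun p : ℝ × ℝ => z p.1 p.2) (Icc a b ×ˢ Icc s t) := by
  rintro ⟨x, y⟩ ⟨hx, hy⟩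
  exact (hz.differentiableAt (x := x) (y := y) ⟨ha.trans_le hx.1, hx.2.trans_lt hb⟩
    ⟨hs.trans_le hy.1, hy.2.trans_lt ht⟩).continuousAt.continuousWithinAt

lemma hasDerivAt_rp (r : ℝ) {y : ℝ} (hy : 0 < y) :
    HasDerivAt (fun y : ℝ => y ^ r) (r * y ^ (r - 1)) y := by
  have := (hasDerivAt_id y).rpow_const (p := r) (Or.inl hy.ne')
  refine this.congr_deriv ?_
  simp only [id]; ring

namespace Ctx
variable {X D m M : ℝ} {q : ℝ → ℝ} {w : ℝ → ℝ → ℝ} (H : Ctx X D q w m M)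
include H

/-- step (iii): from `ψ^{1/2}` to `ψ`. -/
lemma improve {z E : ℝ → ℝ → ℝ} (hz : Sm X D z) (hzb : Bd X (D / 2) z (1 / 2))
    (hEb : Bd X (D / 2) E (-(1 / 2)))
    (heq : ∀ x ∈ Ioo 0 X, ∀ y ∈ Ioo 0 D, dy (dy z) x y = w x y ^ (-(1 / 2) : ℝ) * dx z x y
      + 1 / 2 * (q x * w x y ^ (-(3 / 2) : ℝ)) * z x y + E x y) :
    Bd X (D / 2) z 1 := by
  apply Bd.mk
  intro ε hε
  obtain ⟨Cz, hCz, hz1⟩ := hzb.get (half_pos hε)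
  obtain ⟨CE, hCE, hE1⟩ := hEb.get (half_pos hε)
  obtain ⟨CN, hCN, hN1⟩ := (H.bd_wpow (-(1 / 2))).get (half_pos hε)
  have hX := H.hX
  have hδ0 := H.hδ0
  have hδ1 := H.hδ1
  have hδD := H.hδD
  set A := 2 * (CN * Cz + X * CE) + 1 + X * Cz / (D / 2) with hA
  have hA0 : 0 < A := by positivity
  refine ⟨4 * A / ε, by positivity, fun x hx y hy => ?_⟩
  have hx0 : 0 < x := hε.trans_le hx.1
  suffices h : (x - ε / 2) * |z x y| ≤ 2 * A * y by
    rw [Real.rpow_one]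
    have h2 : ε / 2 * |z x y| ≤ (x - ε / 2) * |z x y| :=
      mul_le_mul_of_nonneg_right (by linarith [hx.1]) (abs_nonneg _)
    rw [div_mul_eq_mul_div, le_div_iff₀ hε]
    linarith
  refine le_of_forall_pos_le_add fun η hη => ?_
  -- choose the lower end
  obtain ⟨s, hs0, hsy, hsη⟩ : ∃ s, 0 < s ∧ s ≤ y ∧ X * Cz * s ^ (1 / 2 : ℝ) ≤ η := by
    have hc : Tendsto (fun s : ℝ => X * Cz * s ^ (1 / 2 : ℝ)) (𝓝[>] 0) (𝓝 0) := by
      have : ContinuousAt (fun s : ℝ => X * Cz * s ^ (1 / 2 : ℝ)) 0 :=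
        continuousAt_const.mul (Real.continuousAt_rpow_const _ _ (Or.inr (by norm_num)))
      have h2 : Tendsto _ _ _ := this
      simp only [Real.zero_rpow (show (1 / 2 : ℝ) ≠ 0 by norm_num), mul_zero] at h2
      exact h2.mono_left nhdsWithin_le_nhds
    have h1 := hc.eventually (gt_mem_nhds hη)
    have h2 : ∀ᶠ s : ℝ in 𝓝[>] 0, s ∈ Ioc 0 y := Ioc_mem_nhdsGT hy.1
    obtain ⟨s, h3, h4⟩ := (h1.and h2).exists
    exact ⟨s, h4.1, h4.2, h3.le⟩
  have key := barrier (z := z) (zx := dx z) (zy := dy z) (zyy := dy (dy z))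
    (N := fun x y => w x y ^ (-(1 / 2) : ℝ))
    (c := fun x y => 1 / 2 * (q x * w x y ^ (-(3 / 2) : ℝ)))
    (g := fun y => A * (2 * y - y ^ (3 / 2 : ℝ)) + η)
    (g' := fun y => A * (2 - 3 / 2 * y ^ (1 / 2 : ℝ)))
    (g'' := fun y => A * (- (3 / 4 * y ^ (-(1 / 2) : ℝ))))
    (e := fun y => CE * y ^ (-(1 / 2) : ℝ)) (n := fun y => CN * Cz * y ^ (-(1 / 2) : ℝ))
    (a := ε / 2) (b := x) (s := s) (t := D / 2) ?_ ?_ ?_ ?_ ?_ ?_ ?_ ?_ ?_ ?_ ?_ ?_ ?_ ?_ x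
    ⟨by linarith [hx.1], le_rfl⟩ y ⟨hsy, hy.2⟩
  · refine key.trans ?_
    have : 0 ≤ y ^ (3 / 2 : ℝ) := Real.rpow_nonneg hy.1.le _
    nlinarith
  all_goals have inx : ∀ x' ∈ Icc (ε / 2) x, x' ∈ Ioo 0 X ∧ x' ∈ Ico (ε / 2) X := fun x' hx' =>
    ⟨⟨by linarith [hx'.1], hx'.2.trans_lt hx.2⟩, hx'.1, hx'.2.trans_lt hx.2⟩
  all_goals have iny : ∀ y' ∈ Icc s (D / 2), y' ∈ Ioo 0 D ∧ y' ∈ Ioc 0 (D / 2) ∧ 0 < y' :=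
    fun y' hy' => ⟨⟨by linarith [hy'.1], by linarith [hy'.2]⟩, ⟨by linarith [hy'.1], hy'.2⟩,
      by linarith [hy'.1]⟩
  · exact hz.contOn (by linarith) hx.2 hs0 hδD
  · intro x' hx' y' hy'
    exact hz.hdx (inx x' (Ioc_subset_Icc_self hx')).1 (iny y' (Ioo_subset_Icc_self hy')).1
  · intro x' hx' y' hy'
    exact hz.hdy (inx x' (Ioc_subset_Icc_self hx')).1 (iny y' (Ioo_subset_Icc_self hy')).1
  · intro x' hx' y' hy'
    exact hz.dy.hdy (inx x' (Ioc_subset_Icc_self hx')).1 (iny y' (Ioo_subset_Icc_self hy')).1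
  · intro y' hy'
    have h0 := (iny y' hy').2.2
    refine (((((hasDerivAt_id y').const_mul 2).sub (hasDerivAt_rp (3 / 2) h0)).const_mul
      A).add_const η).congr_deriv ?_
    norm_num
  · intro y' hy'
    have h0 := (iny y' (Ioo_subset_Icc_self hy')).2.2
    refine ((((hasDerivAt_rp (1 / 2) h0).const_mul (3 / 2)).const_sub 2).const_mul
      A).congr_deriv ?_
    rw [show (1 / 2 - 1 : ℝ) = -(1 / 2) by norm_num]
    ring
  · intro y' hy'
    have h0 := (iny y' hy').2.2
    have h1 : y' ^ (3 / 2 : ℝ) ≤ y' := by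
      have := Real.rpow_le_rpow_of_exponent_ge h0 ((iny y' hy').2.1.2.trans hδ1)
        (show (1 : ℝ) ≤ 3 / 2 by norm_num)
      simpa using this
    have : 0 ≤ A * (2 * y' - y' ^ (3 / 2 : ℝ)) := mul_nonneg hA0.le (by linarith)
    linarith
  · intro x' hx' y' hy'
    exact Real.rpow_nonneg (H.wpos (inx x' (Ioc_subset_Icc_self hx')).1
      (iny y' (Ioo_subset_Icc_self hy')).1).le _
  · intro x' hx' y' hy'
    have := Real.rpow_nonneg (H.wpos (inx x' (Ioc_subset_Icc_self hx')).1
      (iny y' (Ioo_subset_Icc_self hy')).1).le (-(3 / 2))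
    have := H.hq0 x'
    positivity
  · intro x' hx' y' hy'
    have h1 := (inx x' (Ioc_subset_Icc_self hx'))
    have h2 := (iny y' (Ioo_subset_Icc_self hy'))
    rw [heq x' h1.1 y' h2.1]
    refine le_trans (le_of_eq ?_) (hE1 x' h1.2 y' h2.2.1)
    congr 1
    ring
  · intro x' hx' y' hy'
    have h1 := (inx x' (Ioc_subset_Icc_self hx'))
    have h2 := (iny y' (Ioo_subset_Icc_self hy'))
    have h3 := hN1 x' h1.2 y' h2.2.1
    have h4 := hz1 x' h1.2 y' h2.2.1
    have h5 := (le_abs_self _).trans h3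
    have h0 := h2.2.2
    have h6 : y' ^ (1 / 2 : ℝ) ≤ 1 := Real.rpow_le_one h0.le (h2.2.1.2.trans hδ1) (by norm_num)
    have h7 : |z x' y'| ≤ Cz := h4.trans (by nlinarith)
    calc _ ≤ CN * y' ^ (-(1 / 2) : ℝ) * Cz := mul_le_mul h5 h7 (abs_nonneg _) (by positivity)
      _ = _ := by ring
  · intro y' hy'
    have h2 := (iny y' (Ioo_subset_Icc_self hy'))
    have h0 := h2.2.2
    have h3 : 0 < y' ^ (-(1 / 2) : ℝ) := Real.rpow_pos_of_pos h0 _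
    have h4 : (x - ε / 2) * CE ≤ X * CE := mul_le_mul_of_nonneg_right (by linarith [hx.2]) hCE
    have h5 : 0 ≤ X * Cz / (D / 2) := by positivity
    have h6 : 0 ≤ CN * Cz := by positivity
    have h7 : 0 ≤ X * CE := by positivity
    have h8 : CN * Cz + (x - ε / 2) * CE < 3 / 4 * A := by rw [hA]; linarith
    have h9 := mul_lt_mul_of_pos_right h8 h3
    linarith
  · intro x' hx'
    have h1 := inx x' hx'
    have h2 := iny s ⟨le_rfl, hsy.trans hy.2⟩
    have h3 := hz1 x' h1.2 s h2.2.1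
    have h5 : (x - ε / 2) * |z x' s| ≤ X * (Cz * s ^ (1 / 2 : ℝ)) :=
      mul_le_mul (by linarith [hx.2]) h3 (abs_nonneg _) hX.le
    have h6 : s ^ (3 / 2 : ℝ) ≤ s := by
      have := Real.rpow_le_rpow_of_exponent_ge hs0 (h2.2.1.2.trans hδ1)
        (show (1 : ℝ) ≤ 3 / 2 by norm_num)
      simpa using this
    have : 0 ≤ A * (2 * s - s ^ (3 / 2 : ℝ)) := mul_nonneg hA0.le (by linarith)
    linarith
  · intro x' hx'
    have h1 := inx x' hx'
    have h2 := iny (D / 2) ⟨hsy.trans hy.2, le_rfl⟩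
    have h3 := hz1 x' h1.2 (D / 2) h2.2.1
    have h4 : (D / 2) ^ (1 / 2 : ℝ) ≤ 1 := Real.rpow_le_one hδ0.le hδ1 (by norm_num)
    have h5 : (x - ε / 2) * |z x' (D / 2)| ≤ X * Cz :=
      mul_le_mul (by linarith [hx.2]) (h3.trans (by nlinarith)) (abs_nonneg _) hX.le
    have h6 : (D / 2) ^ (3 / 2 : ℝ) ≤ D / 2 := by
      have := Real.rpow_le_rpow_of_exponent_ge hδ0 hδ1
        (show (1 : ℝ) ≤ 3 / 2 by norm_num)
      simpa using this
    have h7 : X * Cz / (D / 2) * (D / 2) = X * Cz := div_mul_cancel₀ _ hδ0.ne'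
    have h8 : X * Cz / (D / 2) ≤ A := by
      rw [hA]
      have : 0 ≤ CN * Cz := by positivity
      have : 0 ≤ X * CE := by positivity
      linarith
    have h9 : X * Cz ≤ A * (D / 2) := by
      rw [← h7]; exact mul_le_mul_of_nonneg_right h8 hδ0.le
    have h10 : A * (D / 2) ≤ A * (2 * (D / 2) - (D / 2) ^ (3 / 2 : ℝ)) :=
      mul_le_mul_of_nonneg_left (by linarith) hA0.le
    linarith

end Ctx
end Ole

open Set
set_option linter.unusedVariables false
namespace Ole
open Filter Topology

lemma exists_small (B : ℝ) {η y : ℝ} (hη : 0 < η) (hy : 0 < y) :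
    ∃ s, 0 < s ∧ s ≤ y ∧ B * s ^ (1 / 2 : ℝ) ≤ η := by
  have hc : Tendsto (fun s : ℝ => B * s ^ (1 / 2 : ℝ)) (𝓝[>] 0) (𝓝 0) := by
    have : ContinuousAt (fun s : ℝ => B * s ^ (1 / 2 : ℝ)) 0 :=
      continuousAt_const.mul (Real.continuousAt_rpow_const _ _ (Or.inr (by norm_num)))
    have h2 : Tendsto _ _ _ := this
    simp only [Real.zero_rpow (show (1 / 2 : ℝ) ≠ 0 by norm_num), mul_zero] at h2
    exact h2.mono_left nhdsWithin_le_nhds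
  have h1 := hc.eventually (gt_mem_nhds hη)
  have h2 : ∀ᶠ s : ℝ in 𝓝[>] 0, s ∈ Ioc 0 y := Ioc_mem_nhdsGT hy
  obtain ⟨s, h3, h4⟩ := (h1.and h2).exists
  exact ⟨s, h4.1, h4.2, h3.le⟩

lemma Sm.diff_le {X D : ℝ} {f : ℝ → ℝ → ℝ} (hf : Sm X D f) {x h y B e : ℝ} (he : 0 < e) (hh : 0 < h)
    (hx : e ≤ x - h) (hxX : x < X) (hy : y ∈ Ioo 0 D)
    (hb : ∀ x' ∈ Ico e X, |Ole.dx f x' y| ≤ B) : |f x y - f (x - h) y| ≤ B * h := by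
  have := (convex_Icc (x - h) x).norm_image_sub_le_of_norm_hasDerivWithin_le
    (f := fun x' => f x' y) (f' := fun x' => Ole.dx f x' y) (C := B)
    (fun x' hx' => (hf.hdx ⟨by linarith [hx'.1], by linarith [hx'.2]⟩ hy).hasDerivWithinAt)
    (fun x' hx' => hb x' ⟨by linarith [hx'.1], by linarith [hx'.2]⟩)
    (left_mem_Icc.2 (by linarith)) (right_mem_Icc.2 (by linarith))
  simpa [abs_of_pos hh] using this

namespace Ctx
variable {X D m M : ℝ} {q : ℝ → ℝ} {w : ℝ → ℝ → ℝ} (H : Ctx X D q w m M)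
include H

set_option maxHeartbeats 1600000 in
/-- step (ii): from `ψ^{-1/2}` to `ψ^{1/2}` through difference quotients. -/
lemma diffq (hk : ∀ j ≤ 1, Bd X (D / 2) (vv w j) 1)
    {v R : ℝ → ℝ → ℝ} (hv : Sm X D v) (hvb : Bd X (D / 2) v 1)
    (hvx : Bd X (D / 2) (dx v) (-(1 / 2))) (hR : Sm X D R) (hRx : Bd X (D / 2) (dx R) (-1))
    (heq : ∀ x ∈ Ioo 0 X, ∀ y ∈ Ioo 0 D, dy (dy v) x y = w x y ^ (-(1 / 2) : ℝ) * dx v x y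
      + 1 / 2 * (q x * w x y ^ (-(3 / 2) : ℝ)) * v x y + R x y) :
    Bd X (D / 2) (dx v) (1 / 2) := by
  set N : ℝ → ℝ → ℝ := fun x y => w x y ^ (-(1 / 2) : ℝ) with hNdef
  set c : ℝ → ℝ → ℝ := fun x y => 1 / 2 * (q x * w x y ^ (-(3 / 2) : ℝ)) with hcdef
  have tN : T X D (Gn w (· ≤ 0) False) N (-(1 / 2)) := .gen (.wpow _)
  have tc : T X D (Gn w (· ≤ 0) False) c (-(3 / 2)) :=
    (((T.coef H.hq).mul (T.gen (.wpow _))).smul _).cast (by norm_num)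
  have hNx : Bd X (D / 2) (dx N) (-(1 / 2)) :=
    (H.T_dx tN).bd H.hδ1 H.hδD (H.gn_bd hk False.elim)
  have hcx : Bd X (D / 2) (dx c) (-(3 / 2)) :=
    (H.T_dx tc).bd H.hδ1 H.hδD (H.gn_bd hk False.elim)
  have sN : Sm X D N := tN.sm H.gn_sm
  have sc : Sm X D c := tc.sm H.gn_sm
  apply Bd.mk
  intro ε hε
  have hε4 : 0 < ε / 4 := by linarith
  obtain ⟨Cv, hCv, hv1⟩ := hvb.get hε4
  obtain ⟨C1, hC1, hvx1⟩ := hvx.get hε4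
  obtain ⟨CR, hCR, hR1⟩ := hRx.get hε4
  obtain ⟨CN, hCN, hN1⟩ := (H.bd_wpow (-(1 / 2))).get hε4
  obtain ⟨Cn, hCn, hNx1⟩ := hNx.get hε4
  obtain ⟨Cc, hCc, hcx1⟩ := hcx.get hε4
  have hX := H.hX
  have hδ0 := H.hδ0
  have hδ1 := H.hδ1
  have hδD := H.hδD
  set Ce := Cn * C1 + Cc * Cv + CR with hCe
  have hCe0 : 0 ≤ Ce := by positivity
  set A := 4 * (CN * C1 + X * Ce) + 1 + X * C1 / (D / 2) with hA
  have hA0 : 0 < A := by positivity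
  refine ⟨2 * A / ε, by positivity, fun x hx y hy => ?_⟩
  have hx0 : 0 < x := hε.trans_le hx.1
  suffices h : (x - ε / 2) * |dx v x y| ≤ A * y ^ (1 / 2 : ℝ) by
    have h2 : ε / 2 * |dx v x y| ≤ (x - ε / 2) * |dx v x y| :=
      mul_le_mul_of_nonneg_right (by linarith [hx.1]) (abs_nonneg _)
    rw [div_mul_eq_mul_div, le_div_iff₀ hε]
    linarith
  suffices hq : ∀ h ∈ Ioo 0 (ε / 4),
      (x - ε / 2) * |(v x y - v (x - h) y) / h| ≤ A * y ^ (1 / 2 : ℝ) by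
    have hd := hv.hdx (x := x) (y := y) ⟨hx0, hx.2⟩ ⟨hy.1, hy.2.trans_lt hδD⟩
    have h1 := (hasDerivAt_iff_tendsto_slope_zero.1 hd).mono_left
      (nhdsWithin_mono 0 (show Iio (0 : ℝ) ⊆ {0}ᶜ from fun t ht => ne_of_lt ht))
    have h2 : Tendsto (fun t => (x - ε / 2) * |t⁻¹ • (v (x + t) y - v x y)|) (𝓝[<] 0)
        (𝓝 ((x - ε / 2) * |dx v x y|)) := h1.abs.const_mul _
    refine le_of_tendsto h2 ?_
    have h3 : ∀ᶠ t : ℝ in 𝓝[<] 0, t ∈ Ioo (-(ε / 4)) 0 := Ioo_mem_nhdsLT (by linarith)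
    filter_upwards [h3] with t ht
    have h4 := hq (-t) ⟨by linarith [ht.2], by linarith [ht.1]⟩
    have : (v x y - v (x - -t) y) / -t = t⁻¹ • (v (x + t) y - v x y) := by
      have := ne_of_lt ht.2
      rw [smul_eq_mul, sub_neg_eq_add]
      field_simp
      ring
    rwa [this] at h4
  intro h hh
  have hh0 := hh.1
  obtain ⟨s, hs0, hsy, hsη⟩ := exists_small (X * (2 * Cv / h)) hA0 hy.1
  have inx : ∀ x' ∈ Icc (ε / 2) x, (x' ∈ Ioo 0 X ∧ x' ∈ Ico (ε / 4) X) ∧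
      (x' - h ∈ Ioo 0 X ∧ x' - h ∈ Ico (ε / 4) X) := fun x' hx' =>
    ⟨⟨⟨by linarith [hx'.1], hx'.2.trans_lt hx.2⟩, by linarith [hx'.1], hx'.2.trans_lt hx.2⟩,
      ⟨⟨by linarith [hx'.1, hh.2], by linarith [hx'.2, hx.2]⟩, by linarith [hx'.1, hh.2],
        by linarith [hx'.2, hx.2]⟩⟩
  have iny : ∀ y' ∈ Icc s (D / 2), y' ∈ Ioo 0 D ∧ y' ∈ Ioc 0 (D / 2) ∧ 0 < y' :=
    fun y' hy' => ⟨⟨by linarith [hy'.1], by linarith [hy'.2]⟩, ⟨by linarith [hy'.1], hy'.2⟩,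
      by linarith [hy'.1]⟩
  have zb : ∀ x' ∈ Icc (ε / 2) x, ∀ y' ∈ Icc s (D / 2),
      |(v x' y' - v (x' - h) y') / h| ≤ C1 * y' ^ (-(1 / 2) : ℝ) := by
    intro x' hx' y' hy'
    rw [abs_div, abs_of_pos hh0, div_le_iff₀ hh0]
    exact hv.diff_le hε4 hh0 (inx x' hx').2.2.1 (inx x' hx').1.1.2 (iny y' hy').1
      (fun x'' hx'' => hvx1 x'' hx'' y' (iny y' hy').2.1)
  have key := barrier (z := fun x y => (v x y - v (x - h) y) / h)
    (zx := fun x y => (dx v x y - dx v (x - h) y) / h)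
    (zy := fun x y => (dy v x y - dy v (x - h) y) / h)
    (zyy := fun x y => (dy (dy v) x y - dy (dy v) (x - h) y) / h)
    (N := N) (c := c)
    (g := fun y => A * y ^ (1 / 2 : ℝ))
    (g' := fun y => A * (1 / 2 * y ^ (-(1 / 2) : ℝ)))
    (g'' := fun y => A * (- (1 / 4 * y ^ (-(3 / 2) : ℝ))))
    (e := fun y => Ce * y ^ (-1 : ℝ)) (n := fun y => CN * C1 * y ^ (-1 : ℝ))
    (a := ε / 2) (b := x) (s := s) (t := D / 2) ?_ ?_ ?_ ?_ ?_ ?_ ?_ ?_ ?_ ?_ ?_ ?_ ?_ ?_ x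
    ⟨by linarith [hx.1], le_rfl⟩ y ⟨hsy, hy.2⟩
  · exact key
  · refine ContinuousOn.div_const (ContinuousOn.sub (hv.contOn (by linarith) hx.2 hs0 hδD) ?_) h
    have := hv.contOn (a := ε / 4) (b := x) (by linarith) hx.2 hs0 hδD
    exact ContinuousOn.comp (g := fun p : ℝ × ℝ => v p.1 p.2)
      (f := fun p : ℝ × ℝ => (p.1 - h, p.2)) this (by fun_prop)
      (fun p hp => ⟨⟨by linarith [hp.1.1, hh.2], by linarith [hp.1.2]⟩, hp.2⟩)
  · intro x' hx' y' hy'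
    have h1 := (inx x' (Ioc_subset_Icc_self hx'))
    have h2 := (iny y' (Ioo_subset_Icc_self hy')).1
    exact ((hv.hdx h1.1.1 h2).sub ((hv.hdx h1.2.1 h2).comp_sub_const x' h)).div_const h
  · intro x' hx' y' hy'
    have h1 := (inx x' (Ioc_subset_Icc_self hx'))
    have h2 := (iny y' (Ioo_subset_Icc_self hy')).1
    exact ((hv.hdy h1.1.1 h2).sub (hv.hdy h1.2.1 h2)).div_const h
  · intro x' hx' y' hy'
    have h1 := (inx x' (Ioc_subset_Icc_self hx'))
    have h2 := (iny y' (Ioo_subset_Icc_self hy')).1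
    exact ((hv.dy.hdy h1.1.1 h2).sub (hv.dy.hdy h1.2.1 h2)).div_const h
  · intro y' hy'
    have h0 := (iny y' hy').2.2
    refine ((hasDerivAt_rp (1 / 2) h0).const_mul A).congr_deriv ?_
    rw [show (1 / 2 - 1 : ℝ) = -(1 / 2) by norm_num]
  · intro y' hy'
    have h0 := (iny y' (Ioo_subset_Icc_self hy')).2.2
    refine (((hasDerivAt_rp (-(1 / 2)) h0).const_mul (1 / 2)).const_mul A).congr_deriv ?_
    rw [show (-(1 / 2) - 1 : ℝ) = -(3 / 2) by norm_num]
    ring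
  · intro y' hy'
    have h0 := (iny y' hy').2.2
    positivity
  · intro x' hx' y' hy'
    exact Real.rpow_nonneg (H.wpos (inx x' (Ioc_subset_Icc_self hx')).1.1
      (iny y' (Ioo_subset_Icc_self hy')).1).le _
  · intro x' hx' y' hy'
    have := Real.rpow_nonneg (H.wpos (inx x' (Ioc_subset_Icc_self hx')).1.1
      (iny y' (Ioo_subset_Icc_self hy')).1).le (-(3 / 2))
    have := H.hq0 x'
    rw [hcdef]
    positivity
  · intro x' hx' y' hy'
    have h1 := (inx x' (Ioc_subset_Icc_self hx'))
    have h2 := (iny y' (Ioo_subset_Icc_self hy'))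
    have h0 := h2.2.2
    rw [heq x' h1.1.1 y' h2.1, heq _ h1.2.1 y' h2.1]
    have e1 := sN.diff_le hε4 hh0 h1.2.2.1 h1.1.1.2 h2.1
      (fun x'' hx'' => hNx1 x'' hx'' y' h2.2.1)
    have e2 := sc.diff_le hε4 hh0 h1.2.2.1 h1.1.1.2 h2.1
      (fun x'' hx'' => hcx1 x'' hx'' y' h2.2.1)
    have e3 := hR.diff_le hε4 hh0 h1.2.2.1 h1.1.1.2 h2.1
      (fun x'' hx'' => hR1 x'' hx'' y' h2.2.1)
    have e4 := hvx1 _ h1.2.2 y' h2.2.1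
    have e5 := hv1 _ h1.2.2 y' h2.2.1
    have f1 : |(N x' y' - N (x' - h) y') * dx v (x' - h) y'| ≤ Cn * C1 * y' ^ (-1 : ℝ) * h := by
      rw [abs_mul]
      have := mul_le_mul e1 e4 (abs_nonneg _) (by positivity)
      refine this.trans (le_of_eq ?_)
      rw [show (-1 : ℝ) = -(1 / 2) + -(1 / 2) by norm_num, Real.rpow_add h0]
      ring
    have f2 : |(c x' y' - c (x' - h) y') * v (x' - h) y'| ≤ Cc * Cv * y' ^ (-1 : ℝ) * h := by
      rw [abs_mul]
      have := mul_le_mul e2 e5 (abs_nonneg _) (by positivity)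
      refine this.trans ?_
      have k : y' ^ (-(3 / 2) : ℝ) * y' ^ (1 : ℝ) ≤ y' ^ (-1 : ℝ) := by
        rw [← Real.rpow_add h0]
        exact Real.rpow_le_rpow_of_exponent_ge h0 (h2.2.1.2.trans hδ1) (by norm_num)
      calc _ = Cc * Cv * h * (y' ^ (-(3 / 2) : ℝ) * y' ^ (1 : ℝ)) := by ring
        _ ≤ Cc * Cv * h * y' ^ (-1 : ℝ) := by gcongr
        _ = _ := by ring
    have f3 : (N x' y' * dx v x' y' + c x' y' * v x' y' + R x' y' -
        (N (x' - h) y' * dx v (x' - h) y' + c (x' - h) y' * v (x' - h) y' + R (x' - h) y')) / h -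
        (N x' y' * ((dx v x' y' - dx v (x' - h) y') / h) +
          c x' y' * ((v x' y' - v (x' - h) y') / h)) =
        ((N x' y' - N (x' - h) y') * dx v (x' - h) y' + (c x' y' - c (x' - h) y') * v (x' - h) y'
          + (R x' y' - R (x' - h) y')) / h := by
      field_simp
      ring
    refine le_trans (le_of_eq (congrArg abs f3)) ?_
    rw [abs_div, abs_of_pos hh0, div_le_iff₀ hh0]
    refine (abs_add_three _ _ _).trans ?_
    rw [hCe]
    linarith
  · intro x' hx' y' hy'
    have h1 := (inx x' (Ioc_subset_Icc_self hx'))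
    have h2 := (iny y' (Ioo_subset_Icc_self hy'))
    have h3 := hN1 x' h1.1.2 y' h2.2.1
    have h4 := zb x' (Ioc_subset_Icc_self hx') y' (Ioo_subset_Icc_self hy')
    have h5 := (le_abs_self _).trans h3
    have h0 := h2.2.2
    refine (mul_le_mul h5 h4 (abs_nonneg _) (by positivity)).trans (le_of_eq ?_)
    rw [show (-1 : ℝ) = -(1 / 2) + -(1 / 2) by norm_num, Real.rpow_add h0]
    ring
  · intro y' hy'
    have h2 := (iny y' (Ioo_subset_Icc_self hy'))
    have h0 := h2.2.2
    have h3 : 0 < y' ^ (-(3 / 2) : ℝ) := Real.rpow_pos_of_pos h0 _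
    have k : y' ^ (-1 : ℝ) ≤ y' ^ (-(3 / 2) : ℝ) :=
      Real.rpow_le_rpow_of_exponent_ge h0 (h2.2.1.2.trans hδ1) (by norm_num)
    have h4 : (x - ε / 2) * Ce ≤ X * Ce := mul_le_mul_of_nonneg_right (by linarith [hx.2]) hCe0
    have h5 : 0 ≤ X * C1 / (D / 2) := by positivity
    have h6 : 0 ≤ CN * C1 := by positivity
    have h7 : 0 ≤ X * Ce := by positivity
    have h8 : CN * C1 + X * Ce < 1 / 4 * A := by rw [hA]; linarith
    have h9 := mul_lt_mul_of_pos_right h8 h3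
    have h10 : (CN * C1 + (x - ε / 2) * Ce) * y' ^ (-1 : ℝ) ≤
      (CN * C1 + X * Ce) * y' ^ (-(3 / 2) : ℝ) :=
      mul_le_mul (by linarith) k (by positivity) (by positivity)
    linarith
  · intro x' hx'
    have h1 := inx x' hx'
    have h2 := iny s ⟨le_rfl, hsy.trans hy.2⟩
    have h3 := hv1 x' h1.1.2 s h2.2.1
    have h4 := hv1 _ h1.2.2 s h2.2.1
    rw [Real.rpow_one] at h3 h4
    have h5 : |(v x' s - v (x' - h) s) / h| ≤ 2 * Cv / h * s := by
      rw [abs_div, abs_of_pos hh0, div_le_iff₀ hh0]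
      have := abs_sub (v x' s) (v (x' - h) s)
      have e : 2 * Cv / h * s * h = 2 * Cv * s := by field_simp
      rw [e]
      linarith
    have h6 : s = s ^ (1 / 2 : ℝ) * s ^ (1 / 2 : ℝ) := by
      rw [← Real.rpow_add hs0]; norm_num
    have h7 := Real.rpow_nonneg hs0.le (1 / 2)
    calc (x - ε / 2) * |(v x' s - v (x' - h) s) / h| ≤ X * (2 * Cv / h * s) :=
          mul_le_mul (by linarith [hx.2]) h5 (abs_nonneg _) hX.le
      _ = X * (2 * Cv / h) * s ^ (1 / 2 : ℝ) * s ^ (1 / 2 : ℝ) := by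
          conv_lhs => rw [h6]
          ring
      _ ≤ A * s ^ (1 / 2 : ℝ) := mul_le_mul_of_nonneg_right hsη h7
  · intro x' hx'
    have h1 := inx x' hx'
    have h3 := zb x' hx' (D / 2) ⟨hsy.trans hy.2, le_rfl⟩
    have h6 : (D / 2) ^ (-(1 / 2) : ℝ) = (D / 2)⁻¹ * (D / 2) ^ (1 / 2 : ℝ) := by
      rw [← Real.rpow_neg_one, ← Real.rpow_add hδ0]; norm_num
    have h8 : X * C1 / (D / 2) ≤ A := by
      rw [hA]
      have : 0 ≤ CN * C1 := by positivity
      have : 0 ≤ X * Ce := by positivity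
      linarith
    calc _ ≤ X * (C1 * (D / 2) ^ (-(1 / 2) : ℝ)) :=
          mul_le_mul (by linarith [hx.2]) h3 (abs_nonneg _) hX.le
      _ = X * C1 / (D / 2) * (D / 2) ^ (1 / 2 : ℝ) := by rw [h6]; ring
      _ ≤ _ := mul_le_mul_of_nonneg_right h8 (by positivity)

end Ctx
end Ole

open Set
set_option linter.unusedVariables false
namespace Ole
open Filter Topology

set_option maxHeartbeats 1000000 in
lemma bern_T1 {B t ρ ζ β α Z W l : ℝ} (hB : 1 ≤ B) (ht0 : 0 ≤ t) (ht : t ≤ B)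
    (hρ0 : 0 ≤ ρ) (hρ : ρ ≤ 1) (hζ0 : 0 ≤ ζ) (hζ : ζ ≤ 1) (hβ : β ^ 2 ≤ 16)
    (hα0 : 0 ≤ α) (hα : α ≤ B) (hl : |l| ≤ B * (1 + |Z|)) :
    2 * t * ζ ^ 4 * ρ ^ 3 * Z ^ 2 + t ^ 2 * (ζ ^ 4 * (2 * Z * l - 2 * α * W ^ 2)
      - α * (12 * ζ ^ 2 * β ^ 2 - 32 * ζ ^ 3) * Z ^ 2 - 16 * α * ζ ^ 3 * β * Z * W)
    ≤ (2 + 355 * B ^ 2 + B ^ 3) * (t * ζ ^ 2 * Z ^ 2 + 1) := by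
  have hB0 : 0 ≤ B := by linarith
  have hz2 : ζ ^ 2 ≤ 1 := pow_le_one₀ hζ0 hζ
  have hr3 : ρ ^ 3 ≤ 1 := pow_le_one₀ hρ0 hρ
  have e1 : 2 * Z * l ≤ B * (1 + 3 * Z ^ 2) := by
    have : Z * l ≤ |Z| * |l| := by rw [← abs_mul]; exact le_abs_self _
    have h2 : |Z| * |l| ≤ |Z| * (B * (1 + |Z|)) := mul_le_mul_of_nonneg_left hl (abs_nonneg _)
    have h3 : |Z| ^ 2 = Z ^ 2 := sq_abs Z
    have h4 : B * (2 * |Z| + 2 * |Z| ^ 2) ≤ B * (1 + 3 * |Z| ^ 2) :=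
      mul_le_mul_of_nonneg_left (by nlinarith [sq_nonneg (|Z| - 1)]) hB0
    rw [← h3]
    nlinarith
  have e2 : ζ ^ 4 * (2 * Z * l) ≤ ζ ^ 2 * (B * (1 + 3 * Z ^ 2)) := by
    calc ζ ^ 4 * (2 * Z * l) ≤ ζ ^ 4 * (B * (1 + 3 * Z ^ 2)) :=
          mul_le_mul_of_nonneg_left e1 (by positivity)
      _ = ζ ^ 2 * (ζ ^ 2 * (B * (1 + 3 * Z ^ 2))) := by ring
      _ ≤ ζ ^ 2 * (1 * (B * (1 + 3 * Z ^ 2))) := by gcongr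
      _ = _ := by ring
  have e3 : 0 ≤ 2 * α * (ζ ^ 2 * W + 4 * ζ * β * Z) ^ 2 := by positivity
  have e4 : α * (ζ ^ 2 * (20 * β ^ 2 + 32 * ζ)) * Z ^ 2 ≤ B * (ζ ^ 2 * 352) * Z ^ 2 := by
    gcongr
    linarith
  have e5 : ζ ^ 4 * (2 * Z * l - 2 * α * W ^ 2)
      - α * (12 * ζ ^ 2 * β ^ 2 - 32 * ζ ^ 3) * Z ^ 2 - 16 * α * ζ ^ 3 * β * Z * W
      ≤ ζ ^ 2 * (B * (1 + 3 * Z ^ 2)) + B * (ζ ^ 2 * 352) * Z ^ 2 := by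
    nlinarith
  have e6 := mul_le_mul_of_nonneg_left e5 (sq_nonneg t)
  have e7 : t ^ 2 * (ζ ^ 2 * (B * (1 + 3 * Z ^ 2)) + B * (ζ ^ 2 * 352) * Z ^ 2)
      ≤ 355 * B ^ 2 * (t * ζ ^ 2 * Z ^ 2) + B ^ 3 := by
    have k1 : t ^ 2 * ζ ^ 2 * B ≤ B ^ 2 * 1 * B := by gcongr
    have k2 : 355 * B * (t * ζ ^ 2 * Z ^ 2) * t ≤ 355 * B * (t * ζ ^ 2 * Z ^ 2) * B := by gcongr
    nlinarith
  have e8 : 2 * t * ζ ^ 4 * ρ ^ 3 * Z ^ 2 ≤ 2 * (t * ζ ^ 2 * Z ^ 2) := by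
    calc 2 * t * ζ ^ 4 * ρ ^ 3 * Z ^ 2 = 2 * t * ζ ^ 2 * Z ^ 2 * (ζ ^ 2 * ρ ^ 3) := by ring
      _ ≤ 2 * t * ζ ^ 2 * Z ^ 2 * (1 * 1) := by gcongr
      _ = _ := by ring
  have e9 : 0 ≤ t * ζ ^ 2 * Z ^ 2 := by positivity
  have e10 : 0 ≤ B ^ 3 * (t * ζ ^ 2 * Z ^ 2) := by positivity
  nlinarith [sq_nonneg B]

set_option maxHeartbeats 1000000 in
lemma bern_T2 {B t ρ ζ β α f Z U p l : ℝ} (hB : 1 ≤ B) (ht0 : 0 ≤ t) (ht : t ≤ B)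
    (hρ0 : 0 ≤ ρ) (hρ : ρ ≤ 1) (hζ0 : 0 ≤ ζ) (hζ : ζ ≤ 1) (hβ : β ^ 2 ≤ 16)
    (hα0 : 1 ≤ B * α) (hα : α ≤ B) (hf : |f| ≤ B) (hU : α * U = Z - ρ * f)
    (hl : |l| ≤ B * (|U| + 1 + |p|)) :
    ρ ^ 3 * ζ ^ 2 * p ^ 2 + t * (ζ ^ 2 * (2 * p * l - 2 * α * U ^ 2)
      - α * (2 * β ^ 2 - 16 * ζ) * p ^ 2 - 8 * α * ζ * β * p * U)
    ≤ - (t * ζ ^ 2 * Z ^ 2) / (2 * B) + (1 + B * (2 * B ^ 3 + 531 * B) + 2 * B ^ 2)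
      * (p ^ 2 + 1) := by
  have hB0 : 0 < B := by linarith
  have hαp : 0 < α := by
    by_contra h
    push Not at h
    nlinarith
  have hz2 : ζ ^ 2 ≤ 1 := pow_le_one₀ hζ0 hζ
  have hr3 : ρ ^ 3 ≤ 1 := pow_le_one₀ hρ0 hρ
  have e1 : 2 * p * l ≤ 1 / 2 * α * U ^ 2 + (2 * B ^ 3 + 3 * B) * p ^ 2 + B := by
    have : p * l ≤ |p| * |l| := by rw [← abs_mul]; exact le_abs_self _
    have h2 : |p| * |l| ≤ |p| * (B * (|U| + 1 + |p|)) :=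
      mul_le_mul_of_nonneg_left hl (abs_nonneg _)
    have h3 : |p| ^ 2 = p ^ 2 := sq_abs p
    have h3' : |U| ^ 2 = U ^ 2 := sq_abs U
    have h4 : B * (2 * |p| + 2 * |p| ^ 2) ≤ B * (1 + 3 * |p| ^ 2) :=
      mul_le_mul_of_nonneg_left (by nlinarith [sq_nonneg (|p| - 1)]) hB0.le
    have h5 : 2 * B * |p| * |U| ≤ 1 / 2 * α * |U| ^ 2 + 2 * B ^ 3 * |p| ^ 2 := by
      -- multiply by `α`
      have k : 0 ≤ (α * |U| - 2 * B * |p|) ^ 2 := sq_nonneg _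
      have k2 : 4 * B ^ 2 * |p| ^ 2 * 1 ≤ 4 * B ^ 2 * |p| ^ 2 * (B * α) :=
        mul_le_mul_of_nonneg_left hα0 (by positivity)
      have k3 : 0 ≤ α * (α * |U| ^ 2 + 4 * B ^ 3 * |p| ^ 2 - 4 * B * |p| * |U|) := by linarith
      have := nonneg_of_mul_nonneg_right k3 hαp
      linarith
    rw [← h3, ← h3']
    linarith
  have e2 : 0 ≤ 1 / 2 * α * (ζ * U + 8 * β * p) ^ 2 := by positivity
  have e3 : α * (30 * β ^ 2 + 16 * ζ) * p ^ 2 ≤ B * 496 * p ^ 2 := by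
    gcongr
    linarith
  have e4 : Z ^ 2 / (2 * B) - B ≤ α * U ^ 2 := by
    have k1 : (α * U) ^ 2 = (Z - ρ * f) ^ 2 := by rw [hU]
    have k2 : (ρ * f) ^ 2 ≤ B ^ 2 := by
      have : |ρ * f| ≤ B := by
        rw [abs_mul, abs_of_nonneg hρ0]
        calc ρ * |f| ≤ 1 * B := mul_le_mul hρ hf (abs_nonneg _) zero_le_one
          _ = B := one_mul _
      exact sq_le_sq' (abs_le.1 this).1 (abs_le.1 this).2
    have k3 : Z ^ 2 / 2 - B ^ 2 ≤ (α * U) ^ 2 := by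
      rw [k1]; nlinarith [sq_nonneg (Z - 2 * (ρ * f))]
    have k4 : (α * U) ^ 2 ≤ B * (α * U ^ 2) := by
      have : α * (α * U ^ 2) ≤ B * (α * U ^ 2) :=
        mul_le_mul_of_nonneg_right hα (by positivity)
      linarith
    have k5 : B * (Z ^ 2 / (2 * B) - B) = Z ^ 2 / 2 - B ^ 2 := by field_simp
    have k6 : B * (Z ^ 2 / (2 * B) - B) ≤ B * (α * U ^ 2) := by linarith
    exact le_of_mul_le_mul_left k6 hB0
  have e5 : ζ ^ 2 * (2 * p * l) ≤
      ζ ^ 2 * (1 / 2 * α * U ^ 2) + ((2 * B ^ 3 + 3 * B) * p ^ 2 + B) := by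
    have k1 := mul_le_mul_of_nonneg_left e1 (sq_nonneg ζ)
    have k2 : ζ ^ 2 * ((2 * B ^ 3 + 3 * B) * p ^ 2 + B) ≤
        1 * ((2 * B ^ 3 + 3 * B) * p ^ 2 + B) := by gcongr
    linarith
  have e4' := mul_le_mul_of_nonneg_left e4 (sq_nonneg ζ)
  have e4'' : ζ ^ 2 * B ≤ 1 * B := by gcongr
  have e6 : ζ ^ 2 * (2 * p * l - 2 * α * U ^ 2)
      - α * (2 * β ^ 2 - 16 * ζ) * p ^ 2 - 8 * α * ζ * β * p * U
      ≤ - (ζ ^ 2 * (Z ^ 2 / (2 * B))) + (2 * B ^ 3 + 531 * B) * p ^ 2 + 2 * B := by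
    have : 0 ≤ 32 * B * p ^ 2 := by positivity
    linarith
  have e7 := mul_le_mul_of_nonneg_left e6 ht0
  have e8 : t * ((2 * B ^ 3 + 531 * B) * p ^ 2 + 2 * B) ≤
      B * ((2 * B ^ 3 + 531 * B) * p ^ 2 + 2 * B) := by gcongr
  have e9 : ρ ^ 3 * ζ ^ 2 * p ^ 2 ≤ 1 * 1 * p ^ 2 := by gcongr
  have e10 : - (t * ζ ^ 2 * Z ^ 2) / (2 * B) = t * (- (ζ ^ 2 * (Z ^ 2 / (2 * B)))) := by ring
  rw [e10]
  have e11 : 0 ≤ B ^ 2 * p ^ 2 := by positivity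
  have e12 : 0 ≤ B * (2 * B ^ 3 + 531 * B) := by positivity
  linarith

def BernNum (B L L' K : ℝ) : Prop :=
    ∀ t ρ ζ β α f ν Z W U p l l' : ℝ, 0 ≤ t → t ≤ B → 0 ≤ ρ → ρ ≤ 1 → 0 ≤ ζ → ζ ≤ 1 →
    β ^ 2 ≤ 16 → 1 ≤ B * α → α ≤ B → |f| ≤ B → |ν| ≤ B → α * U = Z - ρ * f →
    |l| ≤ B * (1 + |Z|) → |l'| ≤ B * (|U| + 1 + |p|) →
    (2 * t * ζ ^ 4 * ρ ^ 3 * Z ^ 2 + t ^ 2 * (ζ ^ 4 * (2 * Z * l - 2 * α * W ^ 2)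
      - α * (12 * ζ ^ 2 * β ^ 2 - 32 * ζ ^ 3) * Z ^ 2 - 16 * α * ζ ^ 3 * β * Z * W))
    + L * (ρ ^ 3 * ζ ^ 2 * p ^ 2 + t * (ζ ^ 2 * (2 * p * l' - 2 * α * U ^ 2)
      - α * (2 * β ^ 2 - 16 * ζ) * p ^ 2 - 8 * α * ζ * β * p * U))
    + L' * (2 * ρ * ν * f - 2 * α * p ^ 2) - 2 * α * K < 0

set_option maxHeartbeats 1000000 in
lemma bern_num {B : ℝ} (hB : 1 ≤ B) : ∃ L L' K : ℝ, 0 ≤ L ∧ 0 ≤ L' ∧ 0 ≤ K ∧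
    BernNum B L L' K := by
  have hB0 : 0 < B := by linarith
  set C1 := 2 + 355 * B ^ 2 + B ^ 3 with hC1
  set C2 := 1 + B * (2 * B ^ 3 + 531 * B) + 2 * B ^ 2 with hC2
  have hC1p : 0 < C1 := by positivity
  have hC2p : 0 < C2 := by positivity
  refine ⟨2 * B * C1, B * (2 * B * C1) * C2, B * (C1 + 2 * B * C1 * C2
    + 2 * B ^ 2 * (B * (2 * B * C1) * C2)), by positivity, by positivity, by positivity, ?_⟩
  intro t ρ ζ β α f ν Z W U p l l' ht0 ht hρ0 hρ hζ0 hζ hβ hα0 hα hf hν hU hl hl'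
  have hαp : 0 < α := by
    by_contra h
    push Not at h
    nlinarith
  have t1 := bern_T1 (W := W) hB ht0 ht hρ0 hρ hζ0 hζ hβ hαp.le hα hl
  have t2 := bern_T2 hB ht0 ht hρ0 hρ hζ0 hζ hβ hα0 hα hf hU hl'
  rw [← hC1] at t1
  rw [← hC2] at t2
  set S1 := 2 * t * ζ ^ 4 * ρ ^ 3 * Z ^ 2 + t ^ 2 * (ζ ^ 4 * (2 * Z * l - 2 * α * W ^ 2)
      - α * (12 * ζ ^ 2 * β ^ 2 - 32 * ζ ^ 3) * Z ^ 2 - 16 * α * ζ ^ 3 * β * Z * W)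
  set S2 := ρ ^ 3 * ζ ^ 2 * p ^ 2 + t * (ζ ^ 2 * (2 * p * l' - 2 * α * U ^ 2)
      - α * (2 * β ^ 2 - 16 * ζ) * p ^ 2 - 8 * α * ζ * β * p * U)
  set Y := t * ζ ^ 2 * Z ^ 2
  set L := 2 * B * C1 with hL
  have hLp : 0 < L := by positivity
  set L' := B * L * C2 with hL'
  have hLp' : 0 < L' := by positivity
  have u2 : L * S2 ≤ - C1 * Y + L * C2 * (p ^ 2 + 1) := by
    have := mul_le_mul_of_nonneg_left t2 hLp.le
    have e : L * (-Y / (2 * B)) = - C1 * Y := by rw [hL]; field_simp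
    linarith
  have u3 : L' * (2 * ρ * ν * f - 2 * α * p ^ 2) ≤ 2 * B ^ 2 * L' - 2 * (L * C2) * p ^ 2 := by
    have k1 : ρ * ν * f ≤ B ^ 2 := by
      refine (le_abs_self _).trans ?_
      rw [abs_mul, abs_mul, abs_of_nonneg hρ0]
      calc ρ * |ν| * |f| ≤ 1 * B * B := by gcongr
        _ = B ^ 2 := by ring
    have k2 := mul_le_mul_of_nonneg_left k1 hLp'.le
    have k3 : (L * C2 * p ^ 2) * 1 ≤ (L * C2 * p ^ 2) * (B * α) :=
      mul_le_mul_of_nonneg_left hα0 (by positivity)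
    have k4 : L' * α * p ^ 2 = (L * C2 * p ^ 2) * (B * α) := by rw [hL']; ring
    linarith
  have u4 : C1 + L * C2 + 2 * B ^ 2 * L' ≤ α * (B * (C1 + L * C2 + 2 * B ^ 2 * L')) := by
    have : (C1 + L * C2 + 2 * B ^ 2 * L') * 1 ≤ (C1 + L * C2 + 2 * B ^ 2 * L') * (B * α) :=
      mul_le_mul_of_nonneg_left hα0 (by positivity)
    linarith
  have u5 : 0 ≤ L * C2 * p ^ 2 := by positivity
  have u6 : 0 < L * C2 := by positivity
  have u7 : 0 ≤ 2 * B ^ 2 * L' := by positivity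
  linarith
end Ole

open Set
set_option linter.unusedVariables false
namespace Ole
open Filter Topology

lemma hasDerivAt_cut (r y : ℝ) :
    HasDerivAt (fun y : ℝ => 1 - 4 * ((y - r) / r) ^ 2) (- (8 * (y - r) / r ^ 2)) y := by
  have h := ((((hasDerivAt_id y).sub_const r).div_const r).pow 2).const_mul 4 |>.const_sub 1
  refine h.congr_deriv ?_
  simp only [id]
  push_cast
  ring

lemma pos_of_mul_neg_left_aux {ρ c : ℝ} (h : ρ ^ 3 * c < 0) (hρ : 0 < ρ) : c < 0 := by
  by_contra hc
  push Not at hc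
  have := mul_nonneg (pow_pos hρ 3).le hc
  linarith

lemma bern_alg {t ρ ζ η A v z p u zx zy zyy px uy f L L' K : ℝ} (hρ : 0 < ρ)
    (he : f = z - A * u) :
    ρ ^ 3 * ((2 * t * (ρ ^ 2 * (ζ ^ 4 * z ^ 2))
      + t ^ 2 * (ρ ^ 2 * (ζ ^ 4 * (2 * z * zx)))
      + L * (ζ ^ 2 * p ^ 2 + t * (ζ ^ 2 * (2 * p * px)))
      + L' * (2 * v * z / (ρ ^ 2) ^ 2)) - A * (t ^ 2 * (ρ ^ 2 * (12 * ζ ^ 2 * η ^ 2 * z ^ 2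
        + 4 * ζ ^ 3 * (-(8 / (ρ ^ 2) ^ 2)) * z ^ 2 + 16 * ζ ^ 3 * η * z * zy
        + ζ ^ 4 * (2 * zy ^ 2 + 2 * z * zyy)))
      + L * (t * (2 * η ^ 2 * p ^ 2 + 2 * ζ * (-(8 / (ρ ^ 2) ^ 2)) * p ^ 2
        + 8 * ζ * η * p * u + ζ ^ 2 * (2 * u ^ 2 + 2 * p * uy)))
      + (L' * ((2 * p ^ 2 + 2 * v * u) / (ρ ^ 2) ^ 2) + K * (2 / (ρ ^ 2) ^ 2)))) =
    (2 * t * ζ ^ 4 * ρ ^ 3 * (ρ * z) ^ 2 + t ^ 2 * (ζ ^ 4 * (2 * (ρ * z) * (ρ ^ 4 * (zx - A * zyy)) - 2 * (A / ρ) * (ρ ^ 3 * zy) ^ 2)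
      - (A / ρ) * (12 * ζ ^ 2 * (η * ρ ^ 2) ^ 2 - 32 * ζ ^ 3) * (ρ * z) ^ 2 - 16 * (A / ρ) * ζ ^ 3 * (η * ρ ^ 2) * (ρ * z) * (ρ ^ 3 * zy)))
    + L * (ρ ^ 3 * ζ ^ 2 * p ^ 2 + t * (ζ ^ 2 * (2 * p * (ρ ^ 3 * (px - A * uy)) - 2 * (A / ρ) * (ρ ^ 2 * u) ^ 2)
      - (A / ρ) * (2 * (η * ρ ^ 2) ^ 2 - 16 * ζ) * p ^ 2 - 8 * (A / ρ) * ζ * (η * ρ ^ 2) * p * (ρ ^ 2 * u)))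
    + L' * (2 * ρ * (v / ρ ^ 2) * f - 2 * (A / ρ) * p ^ 2) - 2 * (A / ρ) * K := by
  subst he
  obtain ⟨a, rfl⟩ : ∃ a, A = a * ρ := ⟨A / ρ, by field_simp⟩
  obtain ⟨ν, rfl⟩ : ∃ ν, v = ν * ρ ^ 2 := ⟨v / ρ ^ 2, by field_simp⟩
  have h1 : a * ρ / ρ = a := by field_simp
  have h2 : ν * ρ ^ 2 / ρ ^ 2 = ν := by field_simp
  obtain ⟨s, hs⟩ : ∃ s, s = ρ⁻¹ := ⟨_, rfl⟩
  have h3 : s * ρ = 1 := by rw [hs]; field_simp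
  rw [h1, h2]
  simp only [div_eq_mul_inv, ← inv_pow, ← hs]
  have h4 : ((s ^ 2) ^ 2) * ρ ^ 4 = 1 := by
    calc _ = (s * ρ) ^ 4 := by ring
      _ = 1 := by rw [h3]; norm_num
  linear_combination
    (ρ ^ 2 * t ^ 2 * a * 32 * ζ ^ 3 * z ^ 2 + L * t * a * 16 * ζ * p ^ 2 + ρ * 2 * L' * ν * z
      - a * L' * (2 * p ^ 2) - 2 * a ^ 2 * L' * ν * u * 0 - a * ρ ^ 2 * 2 * L' * ν * u - 2 * a * K) * h4

set_option maxHeartbeats 1000000 in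
lemma bern_local {B L L' K : ℝ} (hB : 1 ≤ B) (hL : 0 ≤ L) (hL' : 0 ≤ L') (hK : 0 ≤ K)
    (hnum : BernNum B L L' K) {a b r : ℝ} (hab : a ≤ b) (hba : b - a ≤ B) (hr0 : 0 < r) (hr1 : r ≤ 1)
    {A v z p u zx zy zyy px uy f : ℝ → ℝ → ℝ}
    (cv : ContinuousOn (fun q : ℝ × ℝ => v q.1 q.2) (Icc a b ×ˢ Icc (r / 2) (3 * r / 2)))
    (cz : ContinuousOn (fun q : ℝ × ℝ => z q.1 q.2) (Icc a b ×ˢ Icc (r / 2) (3 * r / 2)))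
    (cp : ContinuousOn (fun q : ℝ × ℝ => p q.1 q.2) (Icc a b ×ˢ Icc (r / 2) (3 * r / 2)))
    (hvx : ∀ x ∈ Ioc a b, ∀ y ∈ Ioo (r / 2) (3 * r / 2), HasDerivAt (fun x' => v x' y) (z x y) x)
    (hzx : ∀ x ∈ Ioc a b, ∀ y ∈ Ioo (r / 2) (3 * r / 2), HasDerivAt (fun x' => z x' y) (zx x y) x)
    (hpx : ∀ x ∈ Ioc a b, ∀ y ∈ Ioo (r / 2) (3 * r / 2), HasDerivAt (fun x' => p x' y) (px x y) x)
    (hvy : ∀ x ∈ Ioc a b, ∀ y ∈ Ioo (r / 2) (3 * r / 2), HasDerivAt (v x) (p x y) y)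
    (hpy : ∀ x ∈ Ioc a b, ∀ y ∈ Ioo (r / 2) (3 * r / 2), HasDerivAt (p x) (u x y) y)
    (huy : ∀ x ∈ Ioc a b, ∀ y ∈ Ioo (r / 2) (3 * r / 2), HasDerivAt (u x) (uy x y) y)
    (hzy : ∀ x ∈ Ioc a b, ∀ y ∈ Ioo (r / 2) (3 * r / 2), HasDerivAt (z x) (zy x y) y)
    (hzyy : ∀ x ∈ Ioc a b, ∀ y ∈ Ioo (r / 2) (3 * r / 2), HasDerivAt (zy x) (zyy x y) y)
    (heq : ∀ x ∈ Ioc a b, ∀ y ∈ Ioo (r / 2) (3 * r / 2), z x y = A x y * u x y + f x y)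
    (hA1 : ∀ x ∈ Ioc a b, ∀ y ∈ Ioo (r / 2) (3 * r / 2), √r ≤ B * A x y)
    (hA2 : ∀ x ∈ Ioc a b, ∀ y ∈ Ioo (r / 2) (3 * r / 2), A x y ≤ B * √r)
    (hf : ∀ x ∈ Ioc a b, ∀ y ∈ Ioo (r / 2) (3 * r / 2), |f x y| ≤ B)
    (hv : ∀ x ∈ Icc a b, ∀ y ∈ Icc (r / 2) (3 * r / 2), |v x y| ≤ B * r)
    (hl : ∀ x ∈ Ioc a b, ∀ y ∈ Ioo (r / 2) (3 * r / 2),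
      √r * r * |zx x y - A x y * zyy x y| ≤ B * (1 + √r * |z x y|))
    (hl' : ∀ x ∈ Ioc a b, ∀ y ∈ Ioo (r / 2) (3 * r / 2),
      √r * r * |px x y - A x y * uy x y| ≤ B * (r * |u x y| + 1 + |p x y|)) :
    (b - a) ^ 2 * r * z b r ^ 2 ≤ L' * B ^ 2 + K / 4 := by
  set ζ : ℝ → ℝ := fun y => 1 - 4 * ((y - r) / r) ^ 2 with hζ
  set ζ' : ℝ → ℝ := fun y => - (8 * (y - r) / r ^ 2) with hζ'
  have dζ : ∀ y, HasDerivAt ζ (ζ' y) y := hasDerivAt_cut r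
  have dζ' : ∀ y, HasDerivAt ζ' (- (8 / r ^ 2)) y := fun y => by
    have := (((((hasDerivAt_id y).sub_const r).const_mul 8).div_const (r ^ 2)).neg)
    refine this.congr_deriv ?_
    ring
  have contζ : Continuous ζ := continuous_iff_continuousAt.2 fun y => (dζ y).continuousAt
  have hside : ∀ y ∈ Icc (r / 2) (3 * r / 2), ((y - r) / r) ^ 2 ≤ 1 / 4 := by
    intro y hy
    have : |(y - r) / r| ≤ 1 / 2 := by
      rw [abs_div, abs_of_pos hr0, div_le_iff₀ hr0, abs_le]
      constructor <;> linarith [hy.1, hy.2]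
    have := sq_le_sq' (abs_le.1 this).1 (abs_le.1 this).2
    linarith
  have hvG : ∀ x ∈ Icc a b, ∀ y ∈ Icc (r / 2) (3 * r / 2),
      L' * (v x y / r) ^ 2 + K * ((y - r) / r) ^ 2 ≤ L' * B ^ 2 + K / 4 := by
    intro x hx y hy
    have h1 : |v x y / r| ≤ B := by
      rw [abs_div, abs_of_pos hr0, div_le_iff₀ hr0]; exact hv x hx y hy
    have h2 := sq_le_sq' (abs_le.1 h1).1 (abs_le.1 h1).2
    have h3 := mul_le_mul_of_nonneg_left h2 hL'
    have h4 := mul_le_mul_of_nonneg_left (hside y hy) hK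
    linarith
  have key := max_principle (a := a) (b := b) (s := r / 2) (t := 3 * r / 2)
    (Φ := fun x y => (x - a) ^ 2 * (r * (ζ y ^ 4 * z x y ^ 2)) + L * ((x - a) * (ζ y ^ 2 * p x y ^ 2))
      + (L' * (v x y / r) ^ 2 + K * ((y - r) / r) ^ 2) - (L' * B ^ 2 + K / 4))
    (Φx := fun x y => 2 * (x - a) * (r * (ζ y ^ 4 * z x y ^ 2))
      + (x - a) ^ 2 * (r * (ζ y ^ 4 * (2 * z x y * zx x y)))
      + L * (ζ y ^ 2 * p x y ^ 2 + (x - a) * (ζ y ^ 2 * (2 * p x y * px x y)))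
      + L' * (2 * v x y * z x y / r ^ 2))
    (Φy := fun x y => (x - a) ^ 2 * (r * (4 * ζ y ^ 3 * ζ' y * z x y ^ 2
        + ζ y ^ 4 * (2 * z x y * zy x y)))
      + L * ((x - a) * (2 * ζ y * ζ' y * p x y ^ 2 + ζ y ^ 2 * (2 * p x y * u x y)))
      + (L' * (2 * v x y * p x y / r ^ 2) + K * (2 * (y - r) / r ^ 2)))
    (Φyy := fun x y => (x - a) ^ 2 * (r * (12 * ζ y ^ 2 * ζ' y ^ 2 * z x y ^ 2
        + 4 * ζ y ^ 3 * (-(8 / r ^ 2)) * z x y ^ 2 + 16 * ζ y ^ 3 * ζ' y * z x y * zy x y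
        + ζ y ^ 4 * (2 * zy x y ^ 2 + 2 * z x y * zyy x y)))
      + L * ((x - a) * (2 * ζ' y ^ 2 * p x y ^ 2 + 2 * ζ y * (-(8 / r ^ 2)) * p x y ^ 2
        + 8 * ζ y * ζ' y * p x y * u x y + ζ y ^ 2 * (2 * u x y ^ 2 + 2 * p x y * uy x y)))
      + (L' * ((2 * p x y ^ 2 + 2 * v x y * u x y) / r ^ 2) + K * (2 / r ^ 2)))
    ?_ ?_ ?_ ?_ ?_ ?_ ?_ ?_ b ⟨hab, le_rfl⟩ r ⟨by linarith, by linarith⟩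
  · have h1 : ζ r = 1 := by simp [hζ]
    simp only [h1] at key
    have h2 : 0 ≤ L * ((b - a) * (1 ^ 2 * p b r ^ 2)) := by
      have : 0 ≤ b - a := by linarith
      positivity
    have h3 : 0 ≤ L' * (v b r / r) ^ 2 + K * ((r - r) / r) ^ 2 := by positivity
    linarith
  · have c1 : ContinuousOn (fun q : ℝ × ℝ => ζ q.2) (Icc a b ×ˢ Icc (r / 2) (3 * r / 2)) :=
      (contζ.comp continuous_snd).continuousOn
    fun_prop
  · intro x hx y hy
    have d1 := ((hasDerivAt_id x).sub_const a)
    have d2 := (d1.fun_pow 2).fun_mul ((((hzx x hx y hy).fun_pow 2).const_mul (ζ y ^ 4)).const_mul r)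
    have d3 := (d1.fun_mul (((hpx x hx y hy).fun_pow 2).const_mul (ζ y ^ 2))).const_mul L
    have d4 := ((((hvx x hx y hy).div_const r).fun_pow 2).const_mul L').add_const
      (K * ((y - r) / r) ^ 2)
    refine (((d2.fun_add d3).fun_add d4).sub_const (L' * B ^ 2 + K / 4)).congr_deriv ?_
    simp only [id]
    push_cast
    field_simp
  · intro x hx y hy
    have d2 := ((((dζ y).fun_pow 4).fun_mul ((hzy x hx y hy).fun_pow 2)).const_mul r).const_mul
      ((x - a) ^ 2)
    have d3 := ((((dζ y).fun_pow 2).fun_mul ((hpy x hx y hy).fun_pow 2)).const_mul (x - a)).const_mul L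
    have d4 := (((hvy x hx y hy).div_const r).fun_pow 2).const_mul L'
    have d5 := ((((hasDerivAt_id y).sub_const r).div_const r).fun_pow 2).const_mul K
    refine (((d2.fun_add d3).fun_add (d4.fun_add d5)).sub_const (L' * B ^ 2 + K / 4)).congr_deriv ?_
    simp only [id]
    push_cast
    generalize ζ y = Z1
    generalize ζ' y = Z2
    field_simp
  · intro x hx y hy
    have e1 := dζ y
    have e2 := dζ' y
    have e3 := hzy x hx y hy
    have e4 := hpy x hx y hy
    have d2 := ((((((e1.fun_pow 3).const_mul 4).fun_mul e2).fun_mul (e3.fun_pow 2)).fun_add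
      ((e1.fun_pow 4).fun_mul ((e3.const_mul 2).fun_mul (hzyy x hx y hy)))).const_mul r).const_mul
      ((x - a) ^ 2)
    have d3 := (((((e1.const_mul 2).fun_mul e2).fun_mul (e4.fun_pow 2)).fun_add
      ((e1.fun_pow 2).fun_mul ((e4.const_mul 2).fun_mul (huy x hx y hy)))).const_mul (x - a)).const_mul L
    have d4 := ((((hvy x hx y hy).const_mul 2).fun_mul e4).div_const (r ^ 2)).const_mul L'
    have d5 := ((((hasDerivAt_id y).sub_const r).const_mul 2).div_const (r ^ 2)).const_mul K
    refine ((d2.fun_add d3).fun_add (d4.fun_add d5)).congr_deriv ?_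
    push_cast
    generalize ζ y = Z1
    generalize ζ' y = Z2
    field_simp
    ring
  · intro y hy
    have := hvG a ⟨le_rfl, hab⟩ y hy
    simp only [sub_self]
    linarith
  · intro x hx
    have h1 : ζ (r / 2) = 0 := by
      rw [hζ]; field_simp; norm_num
    have := hvG x hx (r / 2) ⟨le_rfl, by linarith⟩
    rw [h1]
    linarith
  · intro x hx
    have h1 : ζ (3 * r / 2) = 0 := by
      rw [hζ]; field_simp; norm_num
    have := hvG x hx (3 * r / 2) ⟨by linarith, le_rfl⟩
    rw [h1]
    linarith
  · intro x hx y hy _ k2 k3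
    have hA1' := hA1 x hx y hy
    have hA2' := hA2 x hx y hy
    have hf' := hf x hx y hy
    have hv' := hv x (Ioc_subset_Icc_self hx) y (Ioo_subset_Icc_self hy)
    have hl1 := hl x hx y hy
    have hl2 := hl' x hx y hy
    have he := heq x hx y hy
    have hs := hside y (Ioo_subset_Icc_self hy)
    obtain ⟨ρ, hρ⟩ : ∃ ρ, ρ = √r := ⟨_, rfl⟩
    have hρ0 : 0 < ρ := hρ ▸ Real.sqrt_pos.2 hr0
    have hρ1 : ρ ≤ 1 := hρ ▸ Real.sqrt_le_one.2 hr1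
    have hρr : r = ρ ^ 2 := by rw [hρ, Real.sq_sqrt hr0.le]
    rw [← hρ] at hA1' hA2' hl1 hl2
    have hB0 : 0 < B := by linarith
    have hAp : 0 < A x y := by
      by_contra h
      push Not at h
      have := mul_nonpos_of_nonneg_of_nonpos hB0.le h
      linarith
    have hn := hnum (x - a) ρ (ζ y) (ζ' y * ρ ^ 2) (A x y / ρ) (f x y) (v x y / ρ ^ 2) (ρ * z x y)
      (ρ ^ 3 * zy x y) (ρ ^ 2 * u x y) (p x y) (ρ ^ 4 * (zx x y - A x y * zyy x y))
      (ρ ^ 3 * (px x y - A x y * uy x y)) (by linarith [hx.1]) (by linarith [hx.2]) hρ0.le hρ1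
      (by rw [hζ]; linarith) (by rw [hζ]; linarith [sq_nonneg ((y - r) / r)])
      (by
        have : ζ' y * ρ ^ 2 = - 8 * ((y - r) / r) := by
          rw [← hρr, hζ']; field_simp
        rw [this, mul_pow]; linarith)
      (by rw [← mul_div_assoc, le_div_iff₀ hρ0]; linarith)
      (by rw [div_le_iff₀ hρ0]; linarith) hf'
      (by rw [← hρr, abs_div, abs_of_pos hr0, div_le_iff₀ hr0]; exact hv')
      (by rw [he]; field_simp; ring)
      (by
        rw [abs_mul, abs_mul, abs_of_pos hρ0, abs_of_pos (pow_pos hρ0 4)]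
        rw [hρr] at hl1
        calc _ = ρ * (ρ * ρ ^ 2 * |zx x y - A x y * zyy x y|) := by ring
          _ ≤ 1 * (ρ * ρ ^ 2 * |zx x y - A x y * zyy x y|) := by gcongr
          _ ≤ _ := by rw [one_mul]; exact hl1)
      (by
        rw [abs_mul, abs_mul, abs_of_pos (pow_pos hρ0 2), abs_of_pos (pow_pos hρ0 3)]
        rw [hρr] at hl2
        calc _ = ρ * ρ ^ 2 * |px x y - A x y * uy x y| := by ring
          _ ≤ _ := hl2)
    have he' : f x y = z x y - A x y * u x y := by linarith
    rw [← bern_alg (zx := zx x y) (zyy := zyy x y) (px := px x y) (uy := uy x y) (v := v x y)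
      (zy := zy x y) hρ0 he'] at hn
    simp only [hρr] at k2 k3
    have h5 := mul_nonpos_of_nonneg_of_nonpos hAp.le k3
    have h6 := pos_of_mul_neg_left_aux hn hρ0
    linarith
end Ole

open Set
set_option linter.unusedVariables false
namespace Ole
open Filter Topology

lemma rpow_half_neg {y : ℝ} (hy : 0 < y) : y ^ (-(1 / 2) : ℝ) = (√y)⁻¹ := by
  rw [Real.rpow_neg hy.le, ← Real.sqrt_eq_rpow]

lemma bl_A {m M w r y B : ℝ} (hm : 0 < m) (hM : 0 < M) (hr : 0 < r) (h1 : m * y ≤ w) (h2 : w ≤ M * y)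
    (hy1 : r / 2 < y) (hy2 : y < 3 * r / 2) (hB : 1 + 2 / m ≤ B) (hB2 : 1 + 2 * M ≤ B) :
    √r ≤ B * √w ∧ √w ≤ B * √r := by
  have hy0 : 0 < y := by linarith
  have hw : 0 < w := lt_of_lt_of_le (mul_pos hm hy0) h1
  have hm' : 0 < 2 / m := by positivity
  have hB0 : 0 < B := by linarith
  have hBB : B ≤ B ^ 2 := by nlinarith
  constructor
  · rw [← Real.sqrt_sq hB0.le, ← Real.sqrt_mul (by positivity)]
    apply Real.sqrt_le_sqrt
    have : 2 / m * (m * y) ≤ B ^ 2 * w := mul_le_mul (by linarith) h1 (by positivity) (by positivity)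
    have h3 : 2 / m * (m * y) = 2 * y := by field_simp
    linarith
  · rw [← Real.sqrt_sq hB0.le, ← Real.sqrt_mul (by positivity)]
    apply Real.sqrt_le_sqrt
    have h3 : M * y ≤ M * (3 * r / 2) := by gcongr
    have h4 : (1 + 2 * M) * r ≤ B ^ 2 * r := mul_le_mul_of_nonneg_right (by linarith) hr.le
    nlinarith

lemma bl_l {ρ r y B0 C1 C2 Cf A u f z a fx : ℝ} (hρ0 : 0 < ρ) (hρ1 : ρ ≤ 1) (hρr : r = ρ ^ 2)
    (hy1 : r / 2 < y) (hB0 : 0 ≤ B0) (hC1 : 0 ≤ C1) (hC2 : 0 ≤ C2) (hCf : 0 ≤ Cf)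
    (hA0 : 0 ≤ A) (hA : ρ ≤ B0 * A) (hz : z = A * u + f) (hf : |f| ≤ Cf) (ha : |a| ≤ 2 * C1 * ρ)
    (hfx : |fx| ≤ C2 * (1 + y⁻¹ * |z|)) :
    ρ * r * |a * u + fx| ≤ (2 * C1 * B0 * (1 + Cf) + 2 * C2) * (1 + ρ * |z|) := by
  have hr : 0 < r := by rw [hρr]; positivity
  have hr1 : r ≤ 1 := by rw [hρr]; exact pow_le_one₀ hρ0.le hρ1
  have hy0 : 0 < y := by linarith
  have hu : ρ * |u| ≤ B0 * (|z| + Cf) := by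
    calc ρ * |u| ≤ B0 * A * |u| := by gcongr
      _ = B0 * |z - f| := by rw [hz, add_sub_cancel_right, abs_mul, abs_of_nonneg hA0]; ring
      _ ≤ B0 * (|z| + |f|) := by gcongr; exact abs_sub _ _
      _ ≤ _ := by gcongr
  have hry : r * y⁻¹ ≤ 2 := by
    rw [← div_eq_mul_inv, div_le_iff₀ hy0]; linarith
  have h1 : ρ * r * |a * u| ≤ 2 * C1 * B0 * (1 + Cf) * (1 + ρ * |z|) := by
    rw [abs_mul]
    calc ρ * r * (|a| * |u|) = |a| * r * (ρ * |u|) := by ring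
      _ ≤ (2 * C1 * ρ) * 1 * (B0 * (|z| + Cf)) := by gcongr
      _ = 2 * C1 * B0 * (ρ * |z| + ρ * Cf) := by ring
      _ ≤ 2 * C1 * B0 * ((1 + Cf) * (1 + ρ * |z|)) := by
        gcongr
        have : 0 ≤ Cf * (ρ * |z|) := by positivity
        nlinarith
      _ = _ := by ring
  have h2 : ρ * r * |fx| ≤ 2 * C2 * (1 + ρ * |z|) := by
    calc ρ * r * |fx| ≤ ρ * r * (C2 * (1 + y⁻¹ * |z|)) := by gcongr
      _ = C2 * (ρ * r + (r * y⁻¹) * (ρ * |z|)) := by ring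
      _ ≤ C2 * (1 * 1 + 2 * (ρ * |z|)) := by gcongr
      _ ≤ _ := by
        have : 0 ≤ C2 * 1 := by linarith
        linarith
  calc ρ * r * |a * u + fx| ≤ ρ * r * (|a * u| + |fx|) := by gcongr; exact abs_add_le _ _
    _ ≤ _ := by linarith

lemma bl_l' {ρ r y C3 C4 u p a fy : ℝ} (hρ0 : 0 < ρ) (hρ1 : ρ ≤ 1) (hρr : r = ρ ^ 2)
    (hy1 : r / 2 < y) (hC3 : 0 ≤ C3) (hC4 : 0 ≤ C4)
    (ha : ρ * |a| ≤ 2 * C3) (hfy : |fy| ≤ C4 * y⁻¹ * (1 + |p|)) :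
    ρ * r * |a * u + fy| ≤ (2 * C3 + 2 * C4) * (r * |u| + 1 + |p|) := by
  have hr : 0 < r := by rw [hρr]; positivity
  have hy0 : 0 < y := by linarith
  have hry : r * y⁻¹ ≤ 2 := by
    rw [← div_eq_mul_inv, div_le_iff₀ hy0]; linarith
  have h1 : ρ * r * |a * u| ≤ 2 * C3 * (r * |u|) := by
    rw [abs_mul]
    calc ρ * r * (|a| * |u|) = (ρ * |a|) * (r * |u|) := by ring
      _ ≤ _ := by gcongr
  have h2 : ρ * r * |fy| ≤ 2 * C4 * (1 + |p|) := by
    calc ρ * r * |fy| ≤ ρ * r * (C4 * y⁻¹ * (1 + |p|)) := by gcongr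
      _ = ρ * (r * y⁻¹) * (C4 * (1 + |p|)) := by ring
      _ ≤ 1 * 2 * (C4 * (1 + |p|)) := by gcongr
      _ = _ := by ring
  have h3 : 0 ≤ 2 * C3 * (1 + |p|) := by positivity
  have h4 : 0 ≤ 2 * C4 * (r * |u|) := by positivity
  calc ρ * r * |a * u + fy| ≤ ρ * r * (|a * u| + |fy|) := by gcongr; exact abs_add_le _ _
    _ ≤ _ := by linarith

lemma bl_end {ε y G z : ℝ} (hε : 0 < ε) (hy0 : 0 < y) (hG0 : 0 ≤ G)
    (h1 : (ε / 2) ^ 2 * (y * z ^ 2) ≤ G) : |z| ≤ (4 * G / ε ^ 2 + 1) * y ^ (-(1 / 2) : ℝ) := by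
  have h2 : y * z ^ 2 ≤ 4 * G / ε ^ 2 := by
    rw [le_div_iff₀ (by positivity)]
    linarith
  obtain ⟨J, hJ⟩ : ∃ J, J = 4 * G / ε ^ 2 := ⟨_, rfl⟩
  have hJ0 : 0 ≤ J := by rw [hJ]; positivity
  rw [← hJ] at h2 ⊢
  have h5 : 0 ≤ y ^ (-(1 / 2) : ℝ) := Real.rpow_nonneg hy0.le _
  apply abs_le_of_sq_le_sq _ (by positivity)
  rw [rpow_half_neg hy0, mul_pow, inv_pow, Real.sq_sqrt hy0.le, ← div_eq_mul_inv,
    le_div_iff₀ hy0]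
  nlinarith

namespace Ctx
variable {X D m M : ℝ} {q : ℝ → ℝ} {w : ℝ → ℝ → ℝ} (H : Ctx X D q w m M)
include H

set_option maxHeartbeats 1600000 in
/-- step (i): interior gradient estimate -/
lemma bernstein (hk : ∀ j ≤ 1, Bd X (D / 2) (vv w j) 1)
    {v f : ℝ → ℝ → ℝ} (sv : Sm X D v) (hvb : Bd X (D / 2) v 1)
    (sf : Sm X D f) (hfb : Bd X (D / 2) f 0)
    (hfx : BdM X (D / 2) (dx f) 0 (fun x y => 1 + y⁻¹ * |dx v x y|))
    (hfy : BdM X (D / 2) (dy f) (-1) (fun x y => 1 + |dy v x y|))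
    (heq : ∀ x ∈ Ioo 0 X, ∀ y ∈ Ioo 0 D,
      dx v x y = w x y ^ (1 / 2 : ℝ) * dy (dy v) x y + f x y) :
    Bd X (D / 2) (dx v) (-(1 / 2)) := by
  obtain ⟨A, hAd⟩ : ∃ A : ℝ → ℝ → ℝ, A = fun x y => w x y ^ (1 / 2 : ℝ) := ⟨_, rfl⟩
  have tA : T X D (Gn w (· ≤ 0) False) A (1 / 2) := hAd ▸ .gen (.wpow _)
  have sA : Sm X D A := tA.sm H.gn_sm
  have hAx : Bd X (D / 2) (dx A) (1 / 2) := (H.T_dx tA).bd H.hδ1 H.hδD (H.gn_bd hk False.elim)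
  have hAy : Bd X (D / 2) (dy A) (-(1 / 2)) := by
    have h1 := ((T.gen (.wpow (w := w) (K := (· ≤ 1)) (b := False) (1 / 2 - 1))).smul (1 / 2)).bd
      H.hδ1 H.hδD (X := X) (D := D) (H.gn_bd hk False.elim)
    have h2 : Bd X (D / 2) (dy w) 0 := H.bd_dyv hk (j := 0) one_pos
    have := h1.mulM h2
    rw [show (1 / 2 - 1 + 0 : ℝ) = -(1 / 2) by norm_num] at this
    rw [hAd]
    exact this.congr H.hδD fun x hx y hy => (H.dy_wpow _ hx hy).symm
  have hAs : ∀ x y, A x y = √(w x y) := fun x y => by rw [hAd, Real.sqrt_eq_rpow]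
  replace heq : ∀ x ∈ Ioo 0 X, ∀ y ∈ Ioo 0 D, dx v x y = A x y * dy (dy v) x y + f x y := by
    rw [hAd]; exact heq
  have hlz : ∀ x ∈ Ioo 0 X, ∀ y ∈ Ioo 0 D, dx (dx v) x y - A x y * dy (dy (dx v)) x y =
      dx A x y * dy (dy v) x y + dx f x y := by
    intro x hx y hy
    rw [dx_congr heq x hx y hy, isDer_dx.add _ _ (sA.mul sv.dy.dy) sf x hx y hy,
      isDer_dx.mul _ _ sA sv.dy.dy x hx y hy, sv.dy.comm hx hy,
      dy_congr (fun x hx y hy => sv.comm hx hy) x hx y hy]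
    ring
  have hlp : ∀ x ∈ Ioo 0 X, ∀ y ∈ Ioo 0 D, dx (dy v) x y - A x y * dy (dy (dy v)) x y =
      dy A x y * dy (dy v) x y + dy f x y := by
    intro x hx y hy
    rw [sv.comm hx hy, dy_congr heq x hx y hy, isDer_dy.add _ _ (sA.mul sv.dy.dy) sf x hx y hy,
      isDer_dy.mul _ _ sA sv.dy.dy x hx y hy]
    ring
  have hm := H.hm
  have hM := H.hM
  have hX := H.hX
  have hD := H.hD
  have hD1 := H.hD1
  apply Bd.mk
  intro ε hε
  have hε2 : 0 < ε / 2 := by linarith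
  obtain ⟨Cv, hCv, bv⟩ := hvb.get hε2
  obtain ⟨Cf, hCf, bf⟩ := hfb.get hε2
  obtain ⟨C1, hC1, b1⟩ := hAx.get hε2
  obtain ⟨C2, hC2, b2⟩ := hfx _ hε2
  obtain ⟨C3, hC3, b3⟩ := hAy.get hε2
  obtain ⟨C4, hC4, b4⟩ := hfy _ hε2
  obtain ⟨Cb, hCb, bb⟩ := sv.dx.bounded hε (s := D / 3) (t := D / 2) (by linarith) (by linarith)
  set B0 := 1 + 2 / m + 2 * M with hB0
  have hm2 : 0 < 2 / m := by positivity
  have hB0p : 0 < B0 := by positivity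
  have ep1 : 0 ≤ 2 * C1 * B0 * (1 + Cf) := by positivity
  set B := B0 + Cf + 2 * Cv + (2 * C1 * B0 * (1 + Cf) + 2 * C2) + (2 * C3 + 2 * C4) + X with hB
  have hB1 : 1 ≤ B := by linarith
  obtain ⟨L, L', K, hL, hL', hK, hnum⟩ := bern_num hB1
  set G := L' * B ^ 2 + K / 4 with hG
  have hG0 : 0 ≤ G := by positivity
  refine ⟨Cb + (4 * G / ε ^ 2 + 1), by positivity, fun x hx y hy => ?_⟩
  have hy0 := hy.1
  have hyp : 0 < y ^ (-(1 / 2) : ℝ) := Real.rpow_pos_of_pos hy0 _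
  rcases le_total (D / 3) y with hyD | hyD
  · have h1 := bb x hx y ⟨hyD, hy.2⟩
    have h2 : 1 ≤ y ^ (-(1 / 2) : ℝ) :=
      Real.one_le_rpow_of_pos_of_le_one_of_nonpos hy0 (by linarith [hy.2]) (by norm_num)
    have h3 : 0 ≤ 4 * G / ε ^ 2 + 1 := by positivity
    exact (h1.trans (by linarith)).trans (le_mul_of_one_le_right (by linarith) h2)
  obtain ⟨r, hr⟩ : ∃ r, r = y := ⟨_, rfl⟩
  have hr0 : 0 < r := hr ▸ hy0
  have hρ0 : 0 < √r := Real.sqrt_pos.2 hr0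
  have hr1 : r ≤ 1 := by linarith
  have hρ1 : √r ≤ 1 := Real.sqrt_le_one.2 hr1
  have hρr : r = √r ^ 2 := (Real.sq_sqrt hr0.le).symm
  have rx : ∀ x' ∈ Icc (ε / 2) x, x' ∈ Ico (ε / 2) X ∧ x' ∈ Ioo 0 X := fun x' h =>
    ⟨⟨h.1, by linarith [h.2, hx.2]⟩, ⟨by linarith [h.1], by linarith [h.2, hx.2]⟩⟩
  have ry : ∀ y' ∈ Icc (r / 2) (3 * r / 2), y' ∈ Ioc 0 (D / 2) ∧ y' ∈ Ioo 0 D := fun y' h =>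
    ⟨⟨by linarith [h.1], by linarith [h.2]⟩, ⟨by linarith [h.1], by linarith [h.2]⟩⟩
  have cont : ∀ {g : ℝ → ℝ → ℝ}, Sm X D g → ContinuousOn (fun q : ℝ × ℝ => g q.1 q.2)
      (Icc (ε / 2) x ×ˢ Icc (r / 2) (3 * r / 2)) := fun hg =>
    hg.contOn hε2 hx.2 (by linarith) (by linarith)
  have hA0 : ∀ x' ∈ Ioc (ε / 2) x, ∀ y' ∈ Ioo (r / 2) (3 * r / 2), √r ≤ B0 * A x' y' ∧
      A x' y' ≤ B0 * √r := by
    intro x' hx' y' hy'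
    have h1 := (rx x' (Ioc_subset_Icc_self hx')).2
    have h2 := (ry y' (Ioo_subset_Icc_self hy')).2
    rw [hAs]
    exact bl_A hm hM hr0 (H.lb x' ⟨h1.1, h1.2.le⟩ y' h2) (H.ub x' ⟨h1.1, h1.2.le⟩ y' h2)
      hy'.1 hy'.2 (by linarith) (by linarith)
  have hAn : ∀ x y, 0 ≤ A x y := fun x y => by rw [hAs]; exact Real.sqrt_nonneg _
  have key := bern_local hB1 hL hL' hK hnum (a := ε / 2) (b := x) (r := r) (A := A) (v := v)
    (z := dx v) (p := dy v) (u := dy (dy v)) (zx := dx (dx v)) (zy := dy (dx v))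
    (zyy := dy (dy (dx v))) (px := dx (dy v)) (uy := dy (dy (dy v))) (f := f)
    (by linarith [hx.1]) (by linarith [hx.2]) hr0 hr1 (cont sv) (cont sv.dx) (cont sv.dy)
    (fun x' hx' y' hy' => sv.hdx (rx x' (Ioc_subset_Icc_self hx')).2
      (ry y' (Ioo_subset_Icc_self hy')).2)
    (fun x' hx' y' hy' => sv.dx.hdx (rx x' (Ioc_subset_Icc_self hx')).2
      (ry y' (Ioo_subset_Icc_self hy')).2)
    (fun x' hx' y' hy' => sv.dy.hdx (rx x' (Ioc_subset_Icc_self hx')).2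
      (ry y' (Ioo_subset_Icc_self hy')).2)
    (fun x' hx' y' hy' => sv.hdy (rx x' (Ioc_subset_Icc_self hx')).2
      (ry y' (Ioo_subset_Icc_self hy')).2)
    (fun x' hx' y' hy' => sv.dy.hdy (rx x' (Ioc_subset_Icc_self hx')).2
      (ry y' (Ioo_subset_Icc_self hy')).2)
    (fun x' hx' y' hy' => sv.dy.dy.hdy (rx x' (Ioc_subset_Icc_self hx')).2
      (ry y' (Ioo_subset_Icc_self hy')).2)
    (fun x' hx' y' hy' => sv.dx.hdy (rx x' (Ioc_subset_Icc_self hx')).2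
      (ry y' (Ioo_subset_Icc_self hy')).2)
    (fun x' hx' y' hy' => sv.dx.dy.hdy (rx x' (Ioc_subset_Icc_self hx')).2
      (ry y' (Ioo_subset_Icc_self hy')).2)
    (fun x' hx' y' hy' => heq x' (rx x' (Ioc_subset_Icc_self hx')).2 y'
      (ry y' (Ioo_subset_Icc_self hy')).2)
    ?_ ?_ ?_ ?_ ?_ ?_
  · rw [hr] at key
    have hxa : ε / 2 ≤ x - ε / 2 := by linarith [hx.1]
    have h1 : (ε / 2) ^ 2 * (y * dx v x y ^ 2) ≤ G := by
      have : (ε / 2) ^ 2 ≤ (x - ε / 2) ^ 2 := by gcongr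
      have := mul_le_mul_of_nonneg_right this (show 0 ≤ y * dx v x y ^ 2 by positivity)
      linarith
    have h3 := bl_end hε hy0 hG0 h1
    have h4 : 0 ≤ Cb * y ^ (-(1 / 2) : ℝ) := by positivity
    linarith
  · intro x' hx' y' hy'
    refine (hA0 x' hx' y' hy').1.trans (mul_le_mul_of_nonneg_right (by linarith) (hAn _ _))
  · intro x' hx' y' hy'
    refine (hA0 x' hx' y' hy').2.trans (mul_le_mul_of_nonneg_right (by linarith) hρ0.le)
  · intro x' hx' y' hy'
    have := bf x' (rx x' (Ioc_subset_Icc_self hx')).1 y' (ry y' (Ioo_subset_Icc_self hy')).1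
    rw [Real.rpow_zero, mul_one] at this
    linarith
  · intro x' hx' y' hy'
    have := bv x' (rx x' hx').1 y' (ry y' hy').1
    rw [Real.rpow_one] at this
    have h1 : Cv * y' ≤ Cv * (2 * r) := by gcongr; linarith [hy'.2]
    have h2 : 2 * Cv * r ≤ B * r := mul_le_mul_of_nonneg_right (by linarith) hr0.le
    linarith
  · intro x' hx' y' hy'
    have x1 := rx x' (Ioc_subset_Icc_self hx')
    have y1 := ry y' (Ioo_subset_Icc_self hy')
    rw [hlz x' x1.2 y' y1.2]
    have hz := abs_nonneg (dx v x' y')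
    refine (bl_l (A := A x' y') (f := f x' y') (B0 := B0) (C1 := C1) (C2 := C2) (Cf := Cf)
      hρ0 hρ1 hρr hy'.1 hB0p.le hC1 hC2 hCf (hAn _ _)
      (hA0 x' hx' y' hy').1 (heq x' x1.2 y' y1.2) ?_ ?_ ?_).trans
      (mul_le_mul_of_nonneg_right (by linarith) (by positivity))
    · have := bf x' x1.1 y' y1.1
      rwa [Real.rpow_zero, mul_one] at this
    · have h1 := b1 x' x1.1 y' y1.1
      rw [← Real.sqrt_eq_rpow] at h1
      have h2 : √y' ≤ 2 * √r := by
        rw [Real.sqrt_le_left (by positivity), mul_pow, ← hρr]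
        linarith [hy'.2]
      have := mul_le_mul_of_nonneg_left h2 hC1
      linarith
    · have := b2 x' x1.1 y' y1.1
      rwa [Real.rpow_zero, mul_one] at this
  · intro x' hx' y' hy'
    have x1 := rx x' (Ioc_subset_Icc_self hx')
    have y1 := ry y' (Ioo_subset_Icc_self hy')
    rw [hlp x' x1.2 y' y1.2]
    refine (bl_l' (C3 := C3) (C4 := C4) (p := dy v x' y') hρ0 hρ1 hρr hy'.1 hC3 hC4 ?_ ?_).trans
      (mul_le_mul_of_nonneg_right (by linarith) (by positivity))
    · have h1 := b3 x' x1.1 y' y1.1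
      have hy0' := y1.1.1
      rw [rpow_half_neg hy0', ← div_eq_mul_inv, le_div_iff₀ (Real.sqrt_pos.2 hy0')] at h1
      have h2 : √r ≤ 2 * √y' := by
        rw [Real.sqrt_le_left (by positivity), mul_pow, Real.sq_sqrt hy0'.le]
        linarith [hy'.1]
      have := mul_le_mul_of_nonneg_right h2 (abs_nonneg (dy A x' y'))
      linarith
    · have := b4 x' x1.1 y' y1.1
      rwa [Real.rpow_neg_one] at this

end Ctx
end Ole

open Set
set_option linter.unusedVariables false
namespace Ole
open Filter Topology

lemma Bd.mulB' {X δ : ℝ} {f g : ℝ → ℝ → ℝ} {d e c : ℝ} (hf : Bd X δ f d) (hg : Bd X δ g e)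
    (h : d + e = c) : Bd X δ (fun x y => f x y * g x y) c := h ▸ hf.mulM hg

lemma Bd.cons {X δ : ℝ} (c : ℝ) : Bd X δ (fun _ _ => c) 0 := Bd.coef (c := fun _ => c) continuous_const

lemma Bd.smul' {X δ : ℝ} {f : ℝ → ℝ → ℝ} {d : ℝ} (c : ℝ) (hf : Bd X δ f d) :
    Bd X δ (fun x y => c * f x y) d := (Bd.cons c).mulB' hf (by ring)

/-- the multiplier in `T_dxM` -/
lemma Bd.mult {X δ : ℝ} (hδ : δ ≤ 1) {v : ℝ → ℝ → ℝ} {d e : ℝ} (h : Bd X δ v d) (he : e = d - 1)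
    (he0 : e ≤ 0) : Bd X δ (fun x y => 1 + y⁻¹ * |v x y|) e := by
  have h1 : Bd X δ (fun _ _ => (1 : ℝ)) e := (Bd.cons 1).weaken hδ he0
  refine h1.add ?_
  apply Bd.mk
  intro ε hε
  obtain ⟨C, hC, hb⟩ := h.get hε
  refine ⟨C, hC, fun x hx y hy => ?_⟩
  have := hb x hx y hy
  have hy0 := hy.1
  rw [abs_mul, abs_abs, abs_inv, abs_of_pos hy0, he, Real.rpow_sub_one hy0.ne', ← div_eq_inv_mul,
    mul_div_assoc']
  gcongr

namespace Ctx
variable {X D m M : ℝ} {q : ℝ → ℝ} {w : ℝ → ℝ → ℝ} (H : Ctx X D q w m M)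
include H

lemma bd_zero : Bd X (D / 2) (vv w 0) 1 := by
  have := H.bd_wpow 1
  simp only [Real.rpow_one] at this
  exact this

lemma bd_one : Bd X (D / 2) (vv w 1) 1 := by
  obtain ⟨C, hC, hv⟩ := H.v1
  have h1 : Bd X (D / 2) (vv w 1) (1 / 2) := Bd.mk fun ε hε => ⟨C, hC, fun x hx y hy =>
    hv x ⟨hε.trans_le hx.1, hx.2⟩ y ⟨hy.1, hy.2.trans_lt H.hδD⟩⟩
  refine H.improve (H.sm_v 1) h1 ?_ H.struct_one
  refine BdM.add (Bd.smul' _ ?_) (Bd.smul' _ ?_)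
  · exact (H.bd_wpow _).mulB' (h1.mulB' h1 rfl) (by norm_num)
  · exact (Bd.coef (H.contDiff_deriv H.hq).continuous).mulB' (H.bd_wpow _) (by norm_num)

lemma bd_neg_half {n : ℕ} (hk : ∀ j ≤ n + 1, Bd X (D / 2) (vv w j) 1) {P Q : ℝ → ℝ → ℝ}
    (hP : T X D (Gn w (· ≤ n + 1) False) P (1 / 2))
    (hQ : T X D (Gn w (· ≤ n) False) Q (-(1 / 2)))
    (hE : ∀ x ∈ Ioo 0 X, ∀ y ∈ Ioo 0 D, dy (dy (vv w (n + 1))) x y =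
      w x y ^ (-(1 / 2) : ℝ) * vv w (n + 2) x y
      + 1 / 2 * (q x * w x y ^ (-(3 / 2) : ℝ)) * vv w (n + 1) x y + (P x y + Q x y)) :
    Bd X (D / 2) (vv w (n + 2)) (-(1 / 2)) := by
  have hQ' : T X D (Gn w (· ≤ n + 1) False) Q (-(1 / 2)) := by
    refine hQ.mono fun f d h => ?_
    cases h with
    | coef hc => exact .coef hc
    | wpow s => exact .wpow _
    | v h => exact .v (Nat.le_succ_of_le h)
    | dyv h => exact h.elim
  have tf : T X D (Gn w (· ≤ n + 1) False) (fun x y =>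
      (-(1 / 2)) * (q x * (w x y ^ (-1 : ℝ) * vv w (n + 1) x y))
      + (-1) * (w x y ^ (1 / 2 : ℝ) * (P x y + Q x y))) 0 := by
    refine T.add (d := 0) ?_ ?_
    · exact (((T.coef H.hq).mul ((T.gen (.wpow (-1))).mul (T.gen (.v (j := n + 1) (by simp))))).smul (-(1 / 2))).cast (e := 0) (by norm_num)
    · exact (((T.gen (.wpow (1 / 2))).mul ((hP.weaken (e := -(1 / 2)) (by norm_num)).add hQ')).smul (-1)).cast (e := 0) (by norm_num)
  refine H.bernstein (fun j hj => hk j (by omega)) (H.sm_v (n + 1)) (hk _ le_rfl)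
    (tf.sm H.gn_sm) (tf.bd H.hδ1 H.hδD (H.gn_bd hk False.elim))
    (H.T_dxM (by omega) hk tf) (by simpa using H.T_dyM (by omega) hk tf) ?_
  intro x hx y hy
  have hw := H.wpos hx hy
  have e1 : w x y ^ (1 / 2 : ℝ) * w x y ^ (-(1 / 2) : ℝ) = 1 := by
    rw [← Real.rpow_add hw]; norm_num
  have e2 : w x y ^ (1 / 2 : ℝ) * w x y ^ (-(3 / 2) : ℝ) = w x y ^ (-1 : ℝ) := by
    rw [← Real.rpow_add hw]; norm_num
  rw [hE x hx y hy, ← e2]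
  show vv w (n + 2) x y = _
  linear_combination (-vv w (n + 2) x y) * e1

lemma bd_succ {n : ℕ} (hk : ∀ j ≤ n + 1, Bd X (D / 2) (vv w j) 1) :
    Bd X (D / 2) (vv w (n + 2)) 1 := by
  obtain ⟨P, Q, hP, hQ, hE⟩ := H.struct n
  have h1 := H.bd_neg_half hk hP hQ hE
  have sP := hP.sm H.gn_sm
  have sQ := hQ.sm H.gn_sm
  have hPM := H.T_dxM (by omega) hk hP
  have hQx : Bd X (D / 2) (dx Q) (-(1 / 2)) :=
    (H.T_dx hQ).bd H.hδ1 H.hδD (H.gn_bd hk False.elim)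
  have h2 : Bd X (D / 2) (vv w (n + 2)) (1 / 2) := by
    refine H.diffq (fun j hj => hk j (by omega)) (H.sm_v (n + 1)) (hk _ le_rfl) h1 (sP.add sQ) ?_ hE
    have h3 := hPM.toBd (h1.mult H.hδ1 (e := -(3 / 2)) (by norm_num) (by norm_num))
    rw [show (1 / 2 + -(3 / 2) : ℝ) = -1 by norm_num] at h3
    exact (h3.add (hQx.weaken H.hδ1 (by norm_num))).congr H.hδD
      fun x hx y hy => (isDer_dx.add _ _ sP sQ x hx y hy).symm
  have h3 := hPM.toBd (h2.mult H.hδ1 (e := -(1 / 2)) (by norm_num) (by norm_num))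
  have v1 := hk 1 (by omega)
  refine H.improve (H.sm_v (n + 2)) h2 ?_ (H.struct_step sP sQ hE)
  refine BdM.add (BdM.add (h3.weaken H.hδ1 (by norm_num)) (Bd.smul' _ ?_)) (BdM.add hQx ?_)
  · exact ((H.bd_wpow _).mulB' (v1.mulB' h2 rfl) rfl).weaken H.hδ1 (by norm_num)
  · refine Bd.mulB' (d := -(3 / 2)) (BdM.add (Bd.smul' _ ?_) (Bd.smul' _ ?_)) (hk _ le_rfl) (by norm_num)
    · exact (Bd.coef (H.contDiff_deriv H.hq).continuous).mulB' (H.bd_wpow _) (by norm_num)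
    · exact (Bd.coef H.hq.continuous).mulB' ((H.bd_wpow _).mulB' v1 rfl) (by norm_num)

lemma bd_all (k : ℕ) : Bd X (D / 2) (vv w k) 1 := by
  have : ∀ n, ∀ j ≤ n + 1, Bd X (D / 2) (vv w j) 1 := by
    intro n
    induction n with
    | zero =>
      intro j hj
      interval_cases j
      · exact H.bd_zero
      · exact H.bd_one
    | succ n ih =>
      intro j hj
      rcases Nat.lt_or_ge j (n + 2) with h | h
      · exact ih j (by omega)
      · obtain rfl : j = n + 2 := by omega
        exact H.bd_succ ih
  exact this k k (by omega)

/-- iterated `ψ`-derivatives -/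
lemma T_dy {f : ℝ → ℝ → ℝ} {d : ℝ} (h : T X D (Gn w (fun _ => True) True) f d) :
    T X D (Gn w (fun _ => True) True) (dy f) (d - 1) := by
  refine T.isDer (e := 1) isDer_dy H.gn_sm (fun _ _ h => h) ?_ h
  intro f d h
  cases h with
  | coef hc =>
    rw [H.dy_coef]
    exact (T.coef contDiff_const).weaken (by norm_num)
  | wpow s =>
    refine ((((T.gen (.wpow (d - 1))).smul d).mul (T.gen (.dyv (j := 0) trivial))).cast
        (by ring)).congr fun x hx y hy => (H.dy_wpow d hx hy).symm
  | @v j h => exact (T.gen (.dyv (j := j) trivial)).cast (by ring)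
  | @dyv j h =>
    obtain ⟨F, hF, hE⟩ := H.eqn_v j
    have hF' : T X D (Gn w (fun _ => True) True) F (-(1 / 2)) := by
      refine hF.mono fun f d h => ?_
      cases h with
      | coef hc => exact .coef hc
      | wpow s => exact .wpow _
      | v h => exact .v trivial
      | dyv h => exact h.elim
    exact (hF'.weaken (by norm_num)).congr fun x hx y hy => (hE x hx y hy).symm

/-- iterated dy -/
lemma T_iter (k m' : ℕ) : T X D (Gn w (fun _ => True) True) (dy^[m'] (vv w k)) (1 - m') := by
  induction m' with
  | zero => exact (T.gen (.v trivial)).cast (by simp)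
  | succ n ih =>
    rw [Function.iterate_succ_apply']
    exact (H.T_dy ih).cast (by push_cast; ring)

lemma bd_iter (k m' : ℕ) : Bd X (D / 2) (dy^[m'] (vv w k)) (1 - m') :=
  (H.T_iter k m').bd H.hδ1 H.hδD (H.gn_bd (fun j _ => H.bd_all j)
    (fun _ j => H.bd_dyv (k := j + 1) (fun i _ => H.bd_all i) (Nat.lt_succ_self j)))

/-- commutation -/
lemma iter_comm (k m' : ℕ) : ∀ x ∈ Ioo 0 X, ∀ y ∈ Ioo 0 D,
    dx (dy^[m'] (vv w k)) x y = dy^[m'] (vv w (k + 1)) x y := by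
  induction m' with
  | zero => intro x _ y _; rfl
  | succ n ih =>
    intro x hx y hy
    rw [Function.iterate_succ_apply', Function.iterate_succ_apply',
      ((H.T_iter k n).sm H.gn_sm).comm hx hy]
    exact dy_congr ih x hx y hy

lemma vv_iter (k m' : ℕ) : ∀ x ∈ Ioo 0 X, ∀ y ∈ Ioo 0 D,
    vv (dy^[m'] w) k x y = dy^[m'] (vv w k) x y := by
  induction k with
  | zero => intro x _ y _; rfl
  | succ k ih =>
    intro x hx y hy
    rw [← H.iter_comm k m' x hx y hy]
    exact dx_congr ih x hx y hy

end Ctx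
end Ole

open Set
set_option linter.unusedVariables false
namespace Ole
open Filter Topology

lemma iter_dy_eq (w : ℝ → ℝ → ℝ) (n : ℕ) (x y : ℝ) : iteratedDeriv n (w x) y = dy^[n] w x y := by
  induction n generalizing y with
  | zero => simp
  | succ n ih =>
    rw [iteratedDeriv_succ, Function.iterate_succ_apply']
    have : iteratedDeriv n (w x) = dy^[n] w x := funext fun y => ih y
    rw [this]; rfl

lemma iter_dx_eq (F : ℝ → ℝ → ℝ) (n : ℕ) (x y : ℝ) :
    iteratedDeriv n (fun x' => F x' y) x = vv F n x y := by
  induction n generalizing x with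
  | zero => simp [vv]
  | succ n ih =>
    rw [iteratedDeriv_succ]
    have : iteratedDeriv n (fun x' => F x' y) = fun x' => vv F n x' y := funext fun x => ih x
    rw [this]; rfl

lemma pd_eq (k n : ℕ) (w : ℝ → ℝ → ℝ) (x y : ℝ) : pd k n w x y = vv (dy^[n] w) k x y := by
  rw [← iter_dx_eq]
  unfold pd
  congr 1
  funext x'
  exact iter_dy_eq w n x' y

lemma ctx_of {X : ℝ} {p : ℝ → ℝ} {w : ℝ → ℝ → ℝ} {α m M C₀ δ₁ : ℝ}
    (hw : OleinikSolution X p w α m M C₀ δ₁) :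
    Ctx X δ₁ (fun x => -2 * deriv p x) w m M where
  hX := hw.hX
  hD := hw.hδ₁.1
  hD1 := hw.hδ₁.2
  hq := contDiff_const.mul (contDiff_infty_iff_deriv.1 hw.hp).2
  hq0 x := by linarith [hw.hfav x]
  hm := hw.hm
  hM := hw.hm.trans hw.hmM
  smooth := hw.smooth.mono (prod_mono le_rfl Ioo_subset_Ioi_self)
  lb x hx y hy := (hw.growth_lb x (Ioc_subset_Icc_self hx) y (Ioo_subset_Ioc_self hy)).le
  ub x hx y hy := (hw.growth_ub x (Ioc_subset_Icc_self hx) y (Ioo_subset_Ioc_self hy)).le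
  eqn x hx y hy := by
    have h1 := hw.eqn x (Ioo_subset_Ioc_self hx) y hy.1
    have hpos : 0 < w x y := (mul_pos hw.hm hy.1).trans
      (hw.growth_lb x (Ioo_subset_Icc_self hx) y (Ioo_subset_Ioc_self hy))
    rw [pd_eq, pd_eq] at h1
    have h2 : dx w x y - √(w x y) * dy (dy w) x y = -2 * deriv p x := h1
    have h3 : √(w x y) * (√(w x y))⁻¹ = 1 := mul_inv_cancel₀ (Real.sqrt_pos.2 hpos).ne'
    rw [rpow_half_neg hpos, ← h2]
    linear_combination (-dy (dy w) x y) * h3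
  v1 := ⟨C₀, hw.hC₀.le, fun x hx y hy => by
    have h1 := hw.dx_bound x (Ioo_subset_Icc_self hx) y (Ioo_subset_Icc_self hy)
    rw [pd_eq] at h1
    refine le_trans h1 (mul_le_mul_of_nonneg_left ?_ hw.hC₀.le)
    exact Real.rpow_le_rpow_of_exponent_ge hy.1 (hy.2.trans hw.hδ₁.2).le (by linarith [hw.hα.1])⟩

lemma final (X : ℝ) (p : ℝ → ℝ) (w : ℝ → ℝ → ℝ) (α m M C₀ δ₁ : ℝ)
    (hw : OleinikSolution X p w α m M C₀ δ₁)
    (ε : ℝ) (hε : 0 < ε) (hεX : ε < X) (k mm : ℕ) :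
    ∃ δ > 0, ∃ C > 0,
      ∀ x ∈ Set.Icc ε X, ∀ ψ ∈ Set.Ioc (0 : ℝ) δ,
        |pd k mm w x ψ| ≤ C * ψ ^ ((1 : ℝ) - mm) := by
  have H := ctx_of hw
  have hδ := H.hδD
  obtain ⟨C, hC, hb⟩ := (H.bd_iter k mm).get hε
  refine ⟨δ₁ / 2, H.hδ0, C + 1, by linarith, ?_⟩
  have hb' : ∀ x ∈ Ico ε X, ∀ ψ ∈ Ioc 0 (δ₁ / 2), |pd k mm w x ψ| ≤ (C + 1) * ψ ^ ((1 : ℝ) - mm) := by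
    intro x hx ψ hψ
    have h1 := hb x hx ψ hψ
    rw [pd_eq, H.vv_iter k mm x ⟨hε.trans_le hx.1, hx.2⟩ ψ ⟨hψ.1, hψ.2.trans_lt hδ⟩]
    have := Real.rpow_nonneg hψ.1.le ((1 : ℝ) - mm)
    linarith
  intro x hx ψ hψ
  rcases lt_or_eq_of_le hx.2 with h | rfl
  · exact hb' x ⟨hx.1, h⟩ ψ hψ
  have hψ' : ψ ∈ Ioo 0 δ₁ := ⟨hψ.1, hψ.2.trans_lt hδ⟩
  have hcd : ∀ n, ContDiffOn ℝ (⊤ : ℕ∞) (fun z : ℝ × ℝ => dy^[n] w z.1 z.2)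
      (Ioc 0 x ×ˢ Ioo 0 δ₁) := by
    intro n
    induction n with
    | zero => exact H.smooth
    | succ n ih => rw [Function.iterate_succ_apply']; exact contDiffOn_dy ih
  have hSm : ∀ j, Sm x δ₁ (vv (dy^[mm] w) j) := by
    intro j
    induction j with
    | zero => exact ⟨_, hcd mm, fun _ _ _ _ => rfl⟩
    | succ j ih => exact ih.dx
  refine endpoint_bound (f := fun x' => iteratedDeriv mm (w x') ψ) hεX
    (mul_nonneg (by linarith) (Real.rpow_nonneg hψ.1.le _)) k ?_ ?_ (fun x' hx' => hb' x' hx' ψ hψ)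
  · have h1 := (hcd mm).continuousOn (x, ψ) ⟨⟨H.hX, le_rfl⟩, hψ'⟩
    have h2 : ContinuousWithinAt (fun x' => dy^[mm] w x' ψ) (Ioc 0 x) x :=
      h1.comp (f := fun x' : ℝ => (x', ψ)) (by fun_prop) (fun x' hx' => ⟨hx', hψ'⟩)
    simp only [iter_dy_eq]
    refine (h2.mono_of_mem_nhdsWithin ?_)
    exact mem_of_superset (Ioo_mem_nhdsLT H.hX) Ioo_subset_Ioc_self
  · intro x' hx' j
    have h1 : iteratedDeriv j (fun x' => iteratedDeriv mm (w x') ψ) =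
        fun x' => vv (dy^[mm] w) j x' ψ := by
      funext x''
      rw [← iter_dx_eq]
      simp only [iter_dy_eq]
    rw [h1]
    exact ((hSm j).hdx ⟨hε.trans_le hx'.1, hx'.2⟩ hψ').differentiableAt

end Ole

/-- Full regularity of `w`: for any `0 < ε < X` and any integers `k, m ≥ 0`
there exist `δ > 0` and `C > 0` such that `|∂_ψ^m ∂ₓ^k w(x,ψ)| ≤ C ψ^{1-m}`
on `[ε,X] × (0,δ]`. -/
theorem all_derivatives_estimate (X : ℝ) (p : ℝ → ℝ) (w : ℝ → ℝ → ℝ) (α m M C₀ δ₁ : ℝ)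
    (hw : OleinikSolution X p w α m M C₀ δ₁)
    (ε : ℝ) (hε : 0 < ε) (hεX : ε < X) (k mm : ℕ) :
    ∃ δ > 0, ∃ C > 0,
      ∀ x ∈ Set.Icc ε X, ∀ ψ ∈ Set.Ioc (0 : ℝ) δ,
        |pd k mm w x ψ| ≤ C * ψ ^ ((1 : ℝ) - mm) := by
  exact Ole.final X p w α m M C₀ δ₁ hw ε hε hεX k mm
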